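/- Suppose n, d → ∞ with n/d² → α ∈ (0,∞). Define the empirical percentile CDF F_n(ω) = (1/n) Σ_{i=1}^n 1{ Ω_i^{(n)} ≤ ω } for ω ∈ [0,1]. Then for every ω ∈ [0,1], F_n(ω) converges in probability to F(ω), where F(ω) = Φ(Φ^{−1}(ω) − α^{−1/2}) for ω ∈ (0,1), F(0) = 0, and F(1) = 1. -/

import Mathlib

open MeasureTheory ProbabilityTheory Filter Topology Matrix

noncomputable section

/-- The law `N(0, I_d/d)` on `ℝ^d`. -/
def stdGaussianVec (d : ℕ) : Measure (Fin d → ℝ) :=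
  Measure.pi fun _ => gaussianReal 0 (d : NNReal)⁻¹

/-- The Gaussian model: `u_1, …, u_n, v_1, …, v_n` mutually independent `N(0, I_d/d)`. -/
def gaussianModel (d n : ℕ) :
    Measure ((Fin n → Fin d → ℝ) × (Fin n → Fin d → ℝ)) :=
  (Measure.pi fun _ : Fin n => stdGaussianVec d).prod
    (Measure.pi fun _ : Fin n => stdGaussianVec d)

/-- The correlation matrix memory `W^× = U Vᵀ`. -/
def Wcross {d n : ℕ} (u v : Fin n → Fin d → ℝ) : Matrix (Fin d) (Fin d) ℝ :=
  Matrix.of fun a b => ∑ i, u i a * v i b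

/-- The score `s_{j,i} = u_j^⊤ W^× v_i` under the correlation matrix memory. -/
def scoreX {d n : ℕ} (u v : Fin n → Fin d → ℝ) (j i : Fin n) : ℝ :=
  u j ⬝ᵥ (Wcross u v).mulVec (v i)

/-- The signal percentile `Ω_i^{(n)}`. -/
def percentile {d n : ℕ} (p : (Fin n → Fin d → ℝ) × (Fin n → Fin d → ℝ))
    (i : Fin n) : ℝ :=
  (∑ j ∈ Finset.univ.erase i,
      if scoreX p.1 p.2 j i ≤ scoreX p.1 p.2 i i then (1 : ℝ) else 0) / ((n : ℝ) - 1)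

/-- The empirical percentile CDF `F_n(ω) = (1/n) Σ_i 1{Ω_i^{(n)} ≤ ω}`. -/
def empPercCDF {d n : ℕ} (p : (Fin n → Fin d → ℝ) × (Fin n → Fin d → ℝ))
    (ω : ℝ) : ℝ :=
  (∑ i : Fin n, if percentile p i ≤ ω then (1 : ℝ) else 0) / (n : ℝ)

/-- The standard normal CDF `Φ`. -/
def Phi (x : ℝ) : ℝ := (gaussianReal 0 1 (Set.Iic x)).toReal

/-- The standard normal quantile function `Φ⁻¹`. -/
def PhiInv (p : ℝ) : ℝ := sInf {x : ℝ | p ≤ Phi x}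

/-- The limiting percentile CDF: `F(ω) = Φ(Φ⁻¹(ω) − α^{-1/2})` on `(0,1)`, with
`F(0) = 0` and `F(1) = 1`. -/
def limitPercCDF (α ω : ℝ) : ℝ :=
  if ω ≤ 0 then 0 else if 1 ≤ ω then 1 else Phi (PhiInv ω - 1 / Real.sqrt α)

/-! ### Convergence in probability to a constant, along varying probability spaces -/

/-- Convergence in probability to a constant along varying probability spaces. -/
def TIP {Ω : ℕ → Type} [∀ m, MeasurableSpace (Ω m)] (μ : ∀ m, Measure (Ω m))
    {E : Type} [TopologicalSpace E] (X : ∀ m, Ω m → E) (c : E) : Prop :=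
  ∀ U ∈ 𝓝 c, Tendsto (fun m => μ m {ω | X m ω ∉ U}) atTop (𝓝 0)

section TIPsec

variable {Ω : ℕ → Type} [∀ m, MeasurableSpace (Ω m)] {μ : ∀ m, Measure (Ω m)}
  {E F : Type}

theorem TIP.comp [TopologicalSpace E] [TopologicalSpace F] {X : ∀ m, Ω m → E} {c : E}
    (h : TIP μ X c) {f : E → F} (hf : ContinuousAt f c) :
    TIP μ (fun m ω => f (X m ω)) (f c) := fun _ hU => h _ (hf hU)

theorem TIP.prodMk [TopologicalSpace E] [TopologicalSpace F] {X : ∀ m, Ω m → E} {c : E}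
    (h : TIP μ X c) {Y : ∀ m, Ω m → F} {e : F} (h' : TIP μ Y e) :
    TIP μ (fun m ω => (X m ω, Y m ω)) (c, e) := by
  intro U hU
  rw [nhds_prod_eq, Filter.mem_prod_iff] at hU
  obtain ⟨A, hA, B, hB, hAB⟩ := hU
  have := (h A hA).add (h' B hB)
  rw [add_zero] at this
  refine tendsto_of_tendsto_of_tendsto_of_le_of_le tendsto_const_nhds this (fun m => zero_le)
    (fun m => ?_)
  refine (measure_mono ?_).trans (measure_union_le _ _)
  intro ω hω
  by_contra hc
  simp only [Set.mem_union, Set.mem_ofPred_eq, not_or, not_not] at hc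
  exact hω (hAB ⟨hc.1, hc.2⟩)

theorem TIP.det [TopologicalSpace E] {a : ℕ → E} {c : E} (h : Tendsto a atTop (𝓝 c)) :
    TIP μ (fun m _ => a m) c := by
  intro U hU
  refine tendsto_const_nhds.congr' ?_
  filter_upwards [h hU] with m hm
  have : a m ∈ U := hm
  simp [this]

theorem TIP.map {Ω' : ℕ → Type} [∀ m, MeasurableSpace (Ω' m)] {ν : ∀ m, Measure (Ω' m)}
    [TopologicalSpace E] {X : ∀ m, Ω' m → E} {c : E} (h : TIP ν X c)
    {π : ∀ m, Ω m → Ω' m} (hπ : ∀ m, MeasurePreserving (π m) (μ m) (ν m)) :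
    TIP μ (fun m ω => X m (π m ω)) c := by
  intro U hU
  refine tendsto_of_tendsto_of_tendsto_of_le_of_le tendsto_const_nhds (h U hU) (fun m => zero_le)
    (fun m => ?_)
  dsimp only
  rw [← (hπ m).map_eq]
  exact Measure.le_map_apply (hπ m).measurable.aemeasurable {ω | X m ω ∉ U}

theorem TIP.congr [TopologicalSpace E] {X Y : ∀ m, Ω m → E} {c : E}
    (h : TIP μ X c) (hXY : ∀ m ω, X m ω = Y m ω) : TIP μ Y c := by
  intro U hU
  simpa only [hXY] using h U hU

theorem TIP.of_abs {X : ∀ m, Ω m → ℝ} {c : ℝ}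
    (h : ∀ ε > 0, Tendsto (fun m => μ m {ω | ε ≤ |X m ω - c|}) atTop (𝓝 0)) : TIP μ X c := by
  intro U hU
  obtain ⟨ε, hε, hU⟩ := Metric.mem_nhds_iff.1 hU
  refine tendsto_of_tendsto_of_tendsto_of_le_of_le tendsto_const_nhds (h ε hε) (fun m => zero_le)
    (fun m => measure_mono ?_)
  intro ω hω
  by_contra hc
  simp only [Set.mem_ofPred_eq, not_le] at hc
  exact hω (hU (by simpa [Real.dist_eq] using hc))

theorem TIP.abs {X : ∀ m, Ω m → ℝ} {c : ℝ} (h : TIP μ X c) {ε : ℝ} (hε : 0 < ε) :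
    Tendsto (fun m => μ m {ω | ε ≤ |X m ω - c|}) atTop (𝓝 0) := by
  have := h _ (Metric.ball_mem_nhds c hε)
  simpa [Real.dist_eq] using this

theorem TIP.add {X Y : ∀ m, Ω m → ℝ} {a b : ℝ} (hX : TIP μ X a) (hY : TIP μ Y b) :
    TIP μ (fun m ω => X m ω + Y m ω) (a + b) :=
  (hX.prodMk hY).comp (f := fun p : ℝ × ℝ => p.1 + p.2) (by fun_prop)

theorem TIP.mul {X Y : ∀ m, Ω m → ℝ} {a b : ℝ} (hX : TIP μ X a) (hY : TIP μ Y b) :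
    TIP μ (fun m ω => X m ω * Y m ω) (a * b) :=
  (hX.prodMk hY).comp (f := fun p : ℝ × ℝ => p.1 * p.2) (by fun_prop)

theorem TIP.sum {ι : Type} (s : Finset ι) {X : ι → ∀ m, Ω m → ℝ} {a : ι → ℝ}
    (hX : ∀ i ∈ s, TIP μ (X i) (a i)) :
    TIP μ (fun m ω => ∑ i ∈ s, X i m ω) (∑ i ∈ s, a i) := by
  classical
  induction s using Finset.induction_on with
  | empty => simpa using TIP.det (tendsto_const_nhds (x := (0 : ℝ)))
  | insert i s hi ih =>
    have := (hX i (by simp)).add (ih fun j hj => hX j (by simp [hj]))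
    rw [Finset.sum_insert hi]
    exact this.congr fun m ω => by rw [Finset.sum_insert hi]

theorem TIP.integral [∀ m, IsProbabilityMeasure (μ m)] {X : ∀ m, Ω m → ℂ} {c : ℂ} (h : TIP μ X c)
    (hm : ∀ m, Measurable (X m)) (hb : ∀ m ω, ‖X m ω‖ ≤ 1) :
    Tendsto (fun m => ∫ ω, X m ω ∂(μ m)) atTop (𝓝 c) := by
  rw [Metric.tendsto_atTop']
  intro ε hε
  have hK : 0 < 1 + ‖c‖ := by positivity
  have h1 := h _ (Metric.ball_mem_nhds c (half_pos hε))
  have h2 : ∀ᶠ m in atTop, μ m {ω | X m ω ∉ Metric.ball c (ε / 2)} <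
      ENNReal.ofReal (ε / 2 / (1 + ‖c‖)) :=
    h1.eventually (gt_mem_nhds (by simpa using by positivity))
  obtain ⟨N, hN⟩ := eventually_atTop.1 h2
  refine ⟨N, fun m hmN => ?_⟩
  have hN := hN m hmN.le
  set A := {ω | X m ω ∉ Metric.ball c (ε / 2)} with hA
  have hAm : MeasurableSet A := (hm m Metric.isOpen_ball.measurableSet).compl
  have hInt : Integrable (X m) (μ m) :=
    Integrable.of_bound (hm m).aestronglyMeasurable 1 (ae_of_all _ (hb m))
  have e1 : ∫ ω, X m ω ∂(μ m) - c = ∫ ω, (X m ω - c) ∂(μ m) := by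
    rw [integral_sub hInt (integrable_const _)]; simp
  rw [dist_eq_norm, e1]
  have hbd : ∀ ω, ‖X m ω - c‖ ≤ ε / 2 + A.indicator (fun _ => 1 + ‖c‖) ω := by
    intro ω
    by_cases hω : ω ∈ A
    · simp only [hω, Set.indicator_of_mem]
      have := norm_sub_le (X m ω) c
      linarith [hb m ω]
    · simp only [hω, not_false_eq_true, Set.indicator_of_notMem, add_zero]
      simp only [hA, Set.mem_ofPred_eq, not_not, Metric.mem_ball, dist_eq_norm] at hω
      exact hω.le
  calc ‖∫ ω, (X m ω - c) ∂(μ m)‖ ≤ ∫ ω, (ε / 2 + A.indicator (fun _ => 1 + ‖c‖) ω) ∂(μ m) := by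
        refine norm_integral_le_of_norm_le ?_ (ae_of_all _ hbd)
        exact (integrable_const _).add ((integrable_const _).indicator hAm)
    _ = ε / 2 + (μ m).real A * (1 + ‖c‖) := by
        rw [integral_add (integrable_const _) ((integrable_const _).indicator hAm),
          integral_indicator_const _ hAm]
        simp
    _ < ε := by
        have : (μ m).real A < ε / 2 / (1 + ‖c‖) := by
          rw [measureReal_def]
          exact (ENNReal.lt_ofReal_iff_toReal_lt (measure_ne_top _ _)).1 hN
        rw [lt_div_iff₀ hK] at this
        linarith

/-- Conditional Chebyshev. -/
theorem TIP.cond [∀ m, IsProbabilityMeasure (μ m)] {X : ∀ m, Ω m → ℝ}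
    {R : ∀ m, Ω m × Ω m → Ω m}
    (hR : ∀ m, MeasurePreserving (R m) ((μ m).prod (μ m)) (μ m))
    (hX : ∀ m, Measurable (X m)) {B : ∀ m, Ω m → ℝ}
    (hi : ∀ m v, Integrable (fun v' => (X m (R m (v, v'))) ^ 2) (μ m))
    (hB : ∀ m v, ∫ v', (X m (R m (v, v'))) ^ 2 ∂(μ m) ≤ B m v)
    (hB0 : TIP μ B 0) : TIP μ X 0 := by
  refine TIP.of_abs fun ε hε => ?_
  simp only [sub_zero]
  set g : ∀ m, Ω m → ENNReal := fun m v => (μ m) {v' | ε ≤ |X m (R m (v, v'))|} with hg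
  have hms : ∀ m, MeasurableSet {ω | ε ≤ |X m ω|} := fun m =>
    measurableSet_le measurable_const (_root_.continuous_abs.measurable.comp (hX m))
  have hms' : ∀ m, MeasurableSet ((R m) ⁻¹' {ω | ε ≤ |X m ω|}) := fun m =>
    (hR m).measurable (hms m)
  have hgm : ∀ m, Measurable (g m) := fun m => measurable_measure_prodMk_left (hms' m)
  have e1 : ∀ m, μ m {ω | ε ≤ |X m ω|} = ∫⁻ v, g m v ∂(μ m) := by
    intro m
    rw [← (hR m).measure_preimage (hms m).nullMeasurableSet, Measure.prod_apply (hms' m)]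
    rfl
  have hgB : ∀ m v, g m v ≤ ENNReal.ofReal (B m v / ε ^ 2) := by
    intro m v
    have h1 := mul_meas_ge_le_integral_of_nonneg (μ := μ m)
      (ae_of_all _ fun v' => sq_nonneg (X m (R m (v, v')))) (hi m v) (ε ^ 2)
    have h2 : {v' | ε ≤ |X m (R m (v, v'))|} ⊆ {v' | ε ^ 2 ≤ (X m (R m (v, v'))) ^ 2} := by
      intro v' hv'
      simp only [Set.mem_ofPred_eq] at hv' ⊢
      rw [← sq_abs (X m _)]
      gcongr
    refine (measure_mono h2).trans ?_
    rw [← ofReal_measureReal]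
    apply ENNReal.ofReal_le_ofReal
    rw [le_div_iff₀ (by positivity), mul_comm]
    exact h1.trans (hB m v)
  rw [ENNReal.tendsto_nhds_zero]
  intro δ hδ
  by_cases hδt : δ = ⊤
  · simp [hδt]
  set η := δ.toReal / 2 with hη
  have hδ0 : 0 < δ.toReal := ENNReal.toReal_pos hδ.ne' hδt
  have hη0 : 0 < η := by positivity
  have h1 := hB0.abs (ε := η * ε ^ 2) (by positivity)
  rw [ENNReal.tendsto_nhds_zero] at h1
  filter_upwards [h1 (ENNReal.ofReal η) (by simpa using hη0)] with m hm
  rw [e1]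
  have hA : MeasurableSet {v | ENNReal.ofReal η < g m v} :=
    measurableSet_lt measurable_const (hgm m)
  calc ∫⁻ v, g m v ∂(μ m)
      ≤ ∫⁻ v, (ENNReal.ofReal η + {v | ENNReal.ofReal η < g m v}.indicator 1 v) ∂(μ m) := by
        refine lintegral_mono fun v => ?_
        by_cases hv : ENNReal.ofReal η < g m v
        · have hv' : v ∈ {v | ENNReal.ofReal η < g m v} := hv
          simp only [hv', Set.indicator_of_mem, Pi.one_apply]
          exact (prob_le_one).trans le_add_self
        · exact (not_lt.1 hv).trans le_self_add
    _ = ENNReal.ofReal η + μ m {v | ENNReal.ofReal η < g m v} := by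
        rw [lintegral_add_left measurable_const, lintegral_indicator_one hA]
        simp
    _ ≤ ENNReal.ofReal η + ENNReal.ofReal η := by
        gcongr
        refine (measure_mono ?_).trans hm
        intro v hv
        simp only [Set.mem_ofPred_eq, sub_zero] at hv ⊢
        have h3 := hv.trans_le (hgB m v)
        have h4 := (ENNReal.ofReal_lt_ofReal_iff_of_nonneg hη0.le).1 h3
        rw [lt_div_iff₀ (by positivity)] at h4
        exact h4.le.trans (le_abs_self _)
    _ = δ := by
        rw [← ENNReal.ofReal_add hη0.le hη0.le, hη, add_halves, ENNReal.ofReal_toReal hδt]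

end TIPsec

/-- Resampling the coordinates outside `J`. -/
theorem resample {ι E : Type} [Fintype ι] [DecidableEq ι] [MeasurableSpace E] (μ : Measure E)
    [IsProbabilityMeasure μ] (J : Finset ι) :
    MeasurePreserving (fun p : (ι → E) × (ι → E) => fun k => if k ∈ J then p.1 k else p.2 k)
      ((Measure.pi fun _ => μ).prod (Measure.pi fun _ => μ)) (Measure.pi fun _ => μ) := by
  have hmeas : Measurable (fun p : (ι → E) × (ι → E) => fun k => if k ∈ J then p.1 k else p.2 k) := by
    refine measurable_pi_lambda _ fun k => ?_
    by_cases hk : k ∈ J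
    · simp only [hk, if_true]; fun_prop
    · simp only [hk, if_false]; fun_prop
  refine ⟨hmeas, ?_⟩
  symm
  refine Measure.pi_eq fun s hs => ?_
  rw [Measure.map_apply hmeas (MeasurableSet.univ_pi hs)]
  have : (fun p : (ι → E) × (ι → E) => fun k => if k ∈ J then p.1 k else p.2 k) ⁻¹'
      (Set.univ.pi s) = (Set.univ.pi fun k => if k ∈ J then s k else Set.univ) ×ˢ
        (Set.univ.pi fun k => if k ∈ J then Set.univ else s k) := by
    ext p
    simp only [Set.mem_preimage, Set.mem_pi, Set.mem_univ, true_implies, Set.mem_prod]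
    rw [← forall_and]
    refine forall_congr' fun k => ?_
    by_cases hk : k ∈ J <;> simp [hk]
  rw [this, Measure.prod_prod, Measure.pi_pi, Measure.pi_pi, ← Finset.prod_mul_distrib]
  refine Finset.prod_congr rfl fun k _ => ?_
  by_cases hk : k ∈ J <;> simp [hk]

instance (d : ℕ) : IsProbabilityMeasure (stdGaussianVec d) := by
  unfold stdGaussianVec; infer_instance

instance (d n : ℕ) : IsProbabilityMeasure (gaussianModel d n) := by
  unfold gaussianModel; infer_instance

/-- Characteristic function of a standard Gaussian vector. -/
theorem integral_exp_dot (d : ℕ) (x : Fin d → ℝ) :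
    ∫ g, Complex.exp (((g ⬝ᵥ x : ℝ) : ℂ) * Complex.I) ∂(stdGaussianVec d) =
      Complex.exp (((-(x ⬝ᵥ x) / d / 2 : ℝ) : ℂ)) := by
  have h1 : ∀ g : Fin d → ℝ, Complex.exp (((g ⬝ᵥ x : ℝ) : ℂ) * Complex.I) =
      ∏ a, Complex.exp ((x a : ℂ) * (g a : ℂ) * Complex.I) := by
    intro g
    rw [← Complex.exp_sum, ← Finset.sum_mul]
    simp only [dotProduct]
    push_cast
    congr 2
    exact Finset.sum_congr rfl fun a _ => mul_comm _ _
  simp_rw [h1]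
  unfold stdGaussianVec
  rw [integral_fintype_prod_eq_prod
    (f := fun a (y : ℝ) => Complex.exp ((x a : ℂ) * (y : ℂ) * Complex.I))]
  simp_rw [← charFun_apply_real, charFun_gaussianReal]
  rw [← Complex.exp_sum]
  congr 1
  simp only [dotProduct]
  push_cast
  rw [← Finset.sum_neg_distrib, Finset.sum_div, Finset.sum_div]
  refine Finset.sum_congr rfl fun a _ => ?_
  simp
  ring

theorem measurable_dot {d : ℕ} (x : Fin d → ℝ) : Measurable (fun g : Fin d → ℝ => g ⬝ᵥ x) := by
  unfold dotProduct; fun_prop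

/-- Law of a linear functional. -/
theorem map_dot (d : ℕ) (x : Fin d → ℝ) :
    (stdGaussianVec d).map (fun g => g ⬝ᵥ x) = gaussianReal 0 (Real.toNNReal (x ⬝ᵥ x / d)) := by
  have hx : 0 ≤ x ⬝ᵥ x / d := by
    have : 0 ≤ x ⬝ᵥ x := Finset.sum_nonneg fun a _ => mul_self_nonneg _
    positivity
  have : IsProbabilityMeasure ((stdGaussianVec d).map (fun g => g ⬝ᵥ x)) :=
    Measure.isProbabilityMeasure_map (measurable_dot x).aemeasurable
  refine Measure.ext_of_charFun (funext fun t => ?_)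
  rw [charFun_gaussianReal, charFun_apply_real,
    integral_map (measurable_dot x).aemeasurable (by fun_prop)]
  have := integral_exp_dot d (t • x)
  rw [dotProduct_smul, smul_dotProduct] at this
  simp only [dotProduct_smul, smul_eq_mul, Complex.ofReal_mul] at this
  rw [this]
  congr 1
  have h2 : ((Real.toNNReal (x ⬝ᵥ x / d) : NNReal) : ℂ) = ((x ⬝ᵥ x / d : ℝ) : ℂ) := by
    rw [← Real.coe_toNNReal _ hx]; simp
  rw [h2]
  push_cast
  ring

/-- Fourth moment of the standard Gaussian. -/
def C4 : ℝ := ∫ x : ℝ, x ^ 4 ∂(gaussianReal 0 1)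

theorem integrable_pow_gaussian (v : NNReal) (k : ℕ) :
    Integrable (fun x : ℝ => x ^ k) (gaussianReal 0 v) := by
  have := (memLp_id_gaussianReal (μ := 0) (v := v) (k : NNReal)).integrable_norm_pow'
  refine Integrable.mono' (this) (by fun_prop) (ae_of_all _ fun x => ?_)
  simp

theorem gauss4 (v : NNReal) : ∫ x : ℝ, x ^ 4 ∂(gaussianReal 0 v) = C4 * (v : ℝ) ^ 2 := by
  have h := gaussianReal_map_const_mul (μ := 0) (v := 1) (Real.sqrt v)
  have h2 : (NNReal.mk (Real.sqrt v ^ 2) (sq_nonneg _) : NNReal) * 1 = v := by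
    ext; simp
  rw [mul_zero, h2] at h
  rw [← h, integral_map (by fun_prop) (by fun_prop)]
  simp_rw [mul_pow]
  rw [integral_const_mul, C4, mul_comm]
  congr 1
  rw [show (4 : ℕ) = 2 * 2 from rfl, pow_mul, Real.sq_sqrt v.coe_nonneg]

theorem gauss2 (v : NNReal) : ∫ x : ℝ, x ^ 2 ∂(gaussianReal 0 v) = v := by
  have := variance_eq_sub (μ := gaussianReal 0 v) (X := id) (memLp_id_gaussianReal 2)
  rw [variance_id_gaussianReal] at this
  simp at this
  simpa using this.symm

theorem C4_nonneg : 0 ≤ C4 := integral_nonneg fun x => by positivity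

theorem dot_self_nonneg {d : ℕ} (x : Fin d → ℝ) : 0 ≤ x ⬝ᵥ x :=
  Finset.sum_nonneg fun _ _ => mul_self_nonneg _

theorem integrable_dot_pow {d : ℕ} (x : Fin d → ℝ) (k : ℕ) :
    Integrable (fun g => (g ⬝ᵥ x) ^ k) (stdGaussianVec d) := by
  have := integrable_pow_gaussian (Real.toNNReal (x ⬝ᵥ x / d)) k
  rw [← map_dot] at this
  exact this.comp_measurable (measurable_dot x)

theorem dot4 {d : ℕ} (x : Fin d → ℝ) :
    ∫ g, (g ⬝ᵥ x) ^ 4 ∂(stdGaussianVec d) = C4 * (x ⬝ᵥ x / d) ^ 2 := by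
  have hx : 0 ≤ x ⬝ᵥ x / d := by have := dot_self_nonneg x; positivity
  have := gauss4 (Real.toNNReal (x ⬝ᵥ x / d))
  rw [← map_dot, integral_map (measurable_dot x).aemeasurable (by fun_prop),
    Real.coe_toNNReal _ hx] at this
  exact this

theorem dot2 {d : ℕ} (x : Fin d → ℝ) :
    ∫ g, (g ⬝ᵥ x) ^ 2 ∂(stdGaussianVec d) = x ⬝ᵥ x / d := by
  have hx : 0 ≤ x ⬝ᵥ x / d := by have := dot_self_nonneg x; positivity
  have := gauss2 (Real.toNNReal (x ⬝ᵥ x / d))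
  rw [← map_dot, integral_map (measurable_dot x).aemeasurable (by fun_prop),
    Real.coe_toNNReal _ hx] at this
  exact this

theorem dot_mul_mean {d : ℕ} (x y : Fin d → ℝ) :
    ∫ g, (g ⬝ᵥ x) * (g ⬝ᵥ y) ∂(stdGaussianVec d) = x ⬝ᵥ y / d := by
  have h : ∀ g : Fin d → ℝ, (g ⬝ᵥ x) * (g ⬝ᵥ y) =
      ((g ⬝ᵥ (x + y)) ^ 2 - (g ⬝ᵥ (x - y)) ^ 2) / 4 := by
    intro g; rw [dotProduct_add, dotProduct_sub]; ring
  simp_rw [h]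
  rw [integral_div, integral_sub (integrable_dot_pow _ 2) (integrable_dot_pow _ 2), dot2, dot2]
  simp only [dotProduct_add, dotProduct_sub, add_dotProduct, sub_dotProduct]
  rw [dotProduct_comm y x]
  ring

theorem dot_mul_sq_bound {d : ℕ} (x y g : Fin d → ℝ) :
    ((g ⬝ᵥ x) * (g ⬝ᵥ y)) ^ 2 ≤ ((g ⬝ᵥ x) ^ 4 + (g ⬝ᵥ y) ^ 4) / 2 := by
  nlinarith [sq_nonneg ((g ⬝ᵥ x) ^ 2 - (g ⬝ᵥ y) ^ 2)]

theorem dot_mul_memLp {d : ℕ} (x y : Fin d → ℝ) :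
    MemLp (fun g => (g ⬝ᵥ x) * (g ⬝ᵥ y)) 2 (stdGaussianVec d) := by
  have hm : AEStronglyMeasurable (fun g => (g ⬝ᵥ x) * (g ⬝ᵥ y)) (stdGaussianVec d) :=
    ((measurable_dot x).mul (measurable_dot y)).aestronglyMeasurable
  rw [memLp_two_iff_integrable_sq hm]
  refine Integrable.mono' (((integrable_dot_pow x 4).add (integrable_dot_pow y 4)).div_const 2)
    (by fun_prop) (ae_of_all _ fun g => ?_)
  rw [Real.norm_of_nonneg (sq_nonneg _)]
  exact dot_mul_sq_bound x y g

theorem dot_mul_sq_le {d : ℕ} (x y : Fin d → ℝ) :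
    ∫ g, ((g ⬝ᵥ x) * (g ⬝ᵥ y)) ^ 2 ∂(stdGaussianVec d) ≤
      C4 * ((x ⬝ᵥ x / d) ^ 2 + (y ⬝ᵥ y / d) ^ 2) / 2 := by
  calc _ ≤ ∫ g, ((g ⬝ᵥ x) ^ 4 + (g ⬝ᵥ y) ^ 4) / 2 ∂(stdGaussianVec d) :=
        integral_mono (dot_mul_memLp x y).integrable_sq
          (((integrable_dot_pow x 4).add (integrable_dot_pow y 4)).div_const 2)
          (dot_mul_sq_bound x y)
    _ = _ := by
        rw [integral_div, integral_add (integrable_dot_pow x 4) (integrable_dot_pow y 4),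
          dot4, dot4]
        ring

theorem pi_sum_sq {ι : Type} [Fintype ι] {E : Type} [MeasurableSpace E] (μ : Measure E)
    [IsProbabilityMeasure μ] (f : ι → E → ℝ) (hf : ∀ k, MemLp (f k) 2 μ) :
    Integrable (fun v : ι → E => (∑ k, f k (v k) - ∑ k, ∫ g, f k g ∂μ) ^ 2)
        (Measure.pi fun _ => μ) ∧
      ∫ v : ι → E, (∑ k, f k (v k) - ∑ k, ∫ g, f k g ∂μ) ^ 2 ∂(Measure.pi fun _ => μ) ≤
        ∑ k, ∫ g, (f k g) ^ 2 ∂μ := by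
  have hmp : ∀ k : ι, MeasurePreserving (fun v : ι → E => v k) (Measure.pi fun _ => μ) μ :=
    fun k => measurePreserving_eval _ k
  have hL : ∀ k, MemLp (fun v : ι → E => f k (v k)) 2 (Measure.pi fun _ => μ) := fun k =>
    (hf k).comp_measurePreserving (hmp k)
  have hLs : MemLp (fun v : ι → E => ∑ k, f k (v k)) 2 (Measure.pi fun _ => μ) :=
    memLp_finsetSum _ fun k _ => hL k
  have hmean : ∫ v : ι → E, ∑ k, f k (v k) ∂(Measure.pi fun _ => μ) = ∑ k, ∫ g, f k g ∂μ := by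
    rw [integral_finsetSum _ fun k _ => (hL k).integrable (by norm_num)]
    refine Finset.sum_congr rfl fun k _ => ?_
    have h1 := (hmp k).map_eq
    conv_rhs => rw [← h1]
    rw [integral_map (hmp k).measurable.aemeasurable]
    rw [h1]; exact (hf k).aestronglyMeasurable
  have hvar := variance_sum_pi (μ := fun _ : ι => μ) (X := f) hf
  have heq : (∑ i, fun ω : ι → E => f i (ω i)) = fun v => ∑ k, f k (v k) := by
    ext v; simp
  rw [heq, variance_eq_integral hLs.aestronglyMeasurable.aemeasurable, hmean] at hvar
  refine ⟨(hLs.sub (memLp_const _)).integrable_sq, ?_⟩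
  rw [hvar]
  exact Finset.sum_le_sum fun k _ => variance_le_expectation_sq (hf k).aestronglyMeasurable

/-- Law of `n` independent Gaussian vectors. -/
def Pn (d n : ℕ) : Measure (Fin n → Fin d → ℝ) := Measure.pi fun _ : Fin n => stdGaussianVec d

instance (d n : ℕ) : IsProbabilityMeasure (Pn d n) := by unfold Pn; infer_instance

section seqs

variable {n d : ℕ → ℕ}

theorem tendsto_inv_d {d : ℕ → ℕ} (hd : Tendsto d atTop atTop) :
    Tendsto (fun m => 1 / (d m : ℝ)) atTop (𝓝 0) :=
  tendsto_one_div_atTop_nhds_zero_nat.comp hd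

theorem tip_norm (hd1 : ∀ m, 1 ≤ d m) (hd : Tendsto d atTop atTop)
    (i : ∀ m, Fin (n m)) :
    TIP (fun m => Pn (d m) (n m)) (fun m v => v (i m) ⬝ᵥ v (i m)) 1 := by
  have key : TIP (fun m => stdGaussianVec (d m)) (fun m x => x ⬝ᵥ x) 1 := by
    refine TIP.of_abs fun ε hε => ?_
    have hb : ∀ m, stdGaussianVec (d m) {x | ε ≤ |x ⬝ᵥ x - 1|} ≤
        ENNReal.ofReal (C4 / ε ^ 2 * (1 / d m)) := by
      intro m
      have hdm : (0 : ℝ) < d m := by exact_mod_cast hd1 m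
      have hLp : MemLp (fun x : ℝ => x ^ 2) 2 (gaussianReal 0 (d m : NNReal)⁻¹) := by
        rw [memLp_two_iff_integrable_sq (by fun_prop)]
        simpa [← pow_mul] using integrable_pow_gaussian (d m : NNReal)⁻¹ 4
      obtain ⟨h1, h2⟩ := pi_sum_sq (ι := Fin (d m)) (gaussianReal 0 (d m : NNReal)⁻¹)
        (fun _ x => x ^ 2) (fun _ => hLp)
      have e1 : ∑ _k : Fin (d m), ∫ x : ℝ, x ^ 2 ∂(gaussianReal 0 (d m : NNReal)⁻¹) = 1 := by
        rw [gauss2]; simp; field_simp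
      have e2 : ∑ _k : Fin (d m), ∫ x : ℝ, (x ^ 2) ^ 2 ∂(gaussianReal 0 (d m : NNReal)⁻¹)
          = C4 * (1 / d m) := by
        simp_rw [← pow_mul]
        rw [gauss4]; simp; field_simp
      rw [e1] at h1 h2
      rw [e2] at h2
      have e3 : ∀ x : Fin (d m) → ℝ, x ⬝ᵥ x = ∑ k, x k ^ 2 := by
        intro x; simp [dotProduct, sq]
      simp_rw [e3]
      have h3 := mul_meas_ge_le_integral_of_nonneg
        (ae_of_all _ fun v => sq_nonneg _) h1 (ε ^ 2)
      rw [← ofReal_measureReal]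
      apply ENNReal.ofReal_le_ofReal
      rw [div_mul_eq_mul_div, le_div_iff₀ (by positivity), mul_comm]
      refine le_trans ?_ (h3.trans h2)
      refine mul_le_mul_of_nonneg_left (measureReal_mono ?_) (by positivity)
      intro x hx
      simp only [Set.mem_ofPred_eq] at hx ⊢
      rw [← sq_abs (∑ k, x k ^ 2 - 1)]
      gcongr
    have hl : Tendsto (fun m => ENNReal.ofReal (C4 / ε ^ 2 * (1 / d m))) atTop (𝓝 0) := by
      rw [← ENNReal.ofReal_zero]
      refine ENNReal.tendsto_ofReal ?_
      simpa using (tendsto_inv_d hd).const_mul (C4 / ε ^ 2)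
    exact tendsto_of_tendsto_of_tendsto_of_le_of_le tendsto_const_nhds hl (fun _ => zero_le) hb
  exact key.map (μ := fun m => Pn (d m) (n m)) (π := fun m v => v (i m))
    (fun m => measurePreserving_eval _ _)

theorem measurable_vdot {d n : ℕ} (i j : Fin n) :
    Measurable (fun v : Fin n → Fin d → ℝ => v i ⬝ᵥ v j) := by
  unfold dotProduct; fun_prop

theorem tip_cross (hd1 : ∀ m, 1 ≤ d m) (hd : Tendsto d atTop atTop)
    (i j : ∀ m, Fin (n m)) (hij : ∀ m, i m ≠ j m) :
    TIP (fun m => Pn (d m) (n m)) (fun m v => v (i m) ⬝ᵥ v (j m)) 0 := by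
  have hmp : ∀ m, MeasurePreserving (fun v : Fin (n m) → Fin (d m) → ℝ => v (i m))
      (Pn (d m) (n m)) (stdGaussianVec (d m)) := fun m => measurePreserving_eval _ _
  refine TIP.cond (R := fun m p k => if k ∈ ({j m} : Finset _) then p.1 k else p.2 k)
    (fun m => resample _ {j m}) (fun m => measurable_vdot _ _)
    (B := fun m v => v (j m) ⬝ᵥ v (j m) * (1 / d m)) ?_ ?_ ?_
  · intro m v
    simp only [Finset.mem_singleton, hij m, if_true, if_false]
    exact (hmp m).integrable_comp_of_integrable (integrable_dot_pow (v (j m)) 2)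
  · intro m v
    simp only [Finset.mem_singleton, hij m, if_true, if_false]
    have := dot2 (v (j m))
    rw [← (hmp m).map_eq, integral_map (hmp m).measurable.aemeasurable
      ((measurable_dot _).pow_const 2).aestronglyMeasurable] at this
    rw [this, mul_one_div]
  · have := (tip_norm hd1 hd j).mul (TIP.det (μ := fun m => Pn (d m) (n m)) (tendsto_inv_d hd))
    rw [mul_zero] at this
    exact this

theorem tip_delta (hd1 : ∀ m, 1 ≤ d m) (hd : Tendsto d atTop atTop)
    (ι : ∀ m, Fin 3 ↪ Fin (n m)) (r s : Fin 3) :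
    TIP (fun m => Pn (d m) (n m)) (fun m v => v (ι m r) ⬝ᵥ v (ι m s))
      (if r = s then 1 else 0) := by
  split_ifs with h
  · subst h; exact tip_norm hd1 hd _
  · exact tip_cross hd1 hd _ _ fun m => (ι m).injective.ne h

/-- The three special indices. -/
def JJ {N : ℕ} (e : Fin 3 ↪ Fin N) : Finset (Fin N) := Finset.univ.map e

/-- The averaged quadratic form. -/
def QQ {D N : ℕ} (e : Fin 3 ↪ Fin N) (r s : Fin 3) (v : Fin N → Fin D → ℝ) : ℝ :=
  (∑ k, if k ∈ JJ e then 0 else (v k ⬝ᵥ v (e r)) * (v k ⬝ᵥ v (e s))) / D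

theorem measurable_QQ {D N : ℕ} (e : Fin 3 ↪ Fin N) (r s : Fin 3) :
    Measurable (QQ (D := D) e r s) := by
  unfold QQ
  refine Measurable.div_const (Finset.measurable_sum _ fun k _ => ?_) _
  split_ifs
  · exact measurable_const
  · exact (measurable_vdot _ _).mul (measurable_vdot _ _)

theorem mem_JJ {N : ℕ} (e : Fin 3 ↪ Fin N) (r : Fin 3) : e r ∈ JJ e := by simp [JJ]

theorem sum_not_JJ {N : ℕ} (e : Fin 3 ↪ Fin N) (c : ℝ) :
    (∑ k, if k ∈ JJ e then 0 else c) = ((N : ℝ) - 3) * c := by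
  have h : ∀ k, (if k ∈ JJ e then 0 else c) = c - if k ∈ JJ e then c else 0 := by
    intro k; split_ifs <;> simp
  simp_rw [h]
  rw [Finset.sum_sub_distrib, Finset.sum_ite_mem]
  simp [JJ, sub_mul]

theorem tip_QQ (hd1 : ∀ m, 1 ≤ d m) (hd : Tendsto d atTop atTop)
    {α : ℝ} (hlim : Tendsto (fun m => (n m : ℝ) / (d m : ℝ) ^ 2) atTop (𝓝 α))
    (ι : ∀ m, Fin 3 ↪ Fin (n m)) (r s : Fin 3) :
    TIP (fun m => Pn (d m) (n m)) (fun m v => QQ (ι m) r s v) (if r = s then α else 0) := by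
  have h0 := tendsto_inv_d hd
  have key : TIP (fun m => Pn (d m) (n m)) (fun m v => QQ (ι m) r s v -
      ((n m : ℝ) - 3) / (d m : ℝ) ^ 2 * (v (ι m r) ⬝ᵥ v (ι m s))) 0 := by
    have main : ∀ m (v : Fin (n m) → Fin (d m) → ℝ),
        let X := fun v : Fin (n m) → Fin (d m) → ℝ => QQ (ι m) r s v -
          ((n m : ℝ) - 3) / (d m : ℝ) ^ 2 * (v (ι m r) ⬝ᵥ v (ι m s))
        let R := fun (p : (Fin (n m) → Fin (d m) → ℝ) × (Fin (n m) → Fin (d m) → ℝ)) k =>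
          if k ∈ JJ (ι m) then p.1 k else p.2 k
        Integrable (fun v' => (X (R (v, v'))) ^ 2) (Pn (d m) (n m)) ∧
        ∫ v', (X (R (v, v'))) ^ 2 ∂(Pn (d m) (n m)) ≤
          (C4 / 2 * ((n m : ℝ) / (d m : ℝ) ^ 2) * ((1 / d m) * (1 / d m))) *
            ((v (ι m r) ⬝ᵥ v (ι m r)) * (v (ι m r) ⬝ᵥ v (ι m r)) +
              (v (ι m s) ⬝ᵥ v (ι m s)) * (v (ι m s) ⬝ᵥ v (ι m s))) := by
      intro m v X R
      have hdm : (0 : ℝ) < d m := by exact_mod_cast hd1 m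
      set x := v (ι m r) with hx
      set y := v (ι m s) with hy
      set f : Fin (n m) → (Fin (d m) → ℝ) → ℝ := fun k g =>
        if k ∈ JJ (ι m) then 0 else (g ⬝ᵥ x) * (g ⬝ᵥ y) / d m with hf
      have hfL : ∀ k, MemLp (f k) 2 (stdGaussianVec (d m)) := by
        intro k
        simp only [hf]
        split_ifs
        · exact memLp_const 0
        · simpa only [div_eq_inv_mul] using (dot_mul_memLp x y).const_mul ((d m : ℝ)⁻¹)
      have hmean : ∑ k, ∫ g, f k g ∂(stdGaussianVec (d m)) =
          ((n m : ℝ) - 3) / (d m : ℝ) ^ 2 * (x ⬝ᵥ y) := by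
        have : ∀ k, ∫ g, f k g ∂(stdGaussianVec (d m)) =
            if k ∈ JJ (ι m) then 0 else x ⬝ᵥ y / (d m : ℝ) ^ 2 := by
          intro k
          simp only [hf]
          split_ifs
          · simp
          · rw [integral_div, dot_mul_mean]; field_simp
        simp_rw [this]
        rw [sum_not_JJ]; ring
      have hXR : ∀ v', X (R (v, v')) = ∑ k, f k (v' k) -
          ∑ k, ∫ g, f k g ∂(stdGaussianVec (d m)) := by
        intro v'
        rw [hmean]
        simp only [X, R, QQ, mem_JJ, if_true, ← hx, ← hy]
        congr 1
        rw [Finset.sum_div]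
        refine Finset.sum_congr rfl fun k _ => ?_
        simp only [hf]
        split_ifs <;> simp
      simp_rw [hXR]
      obtain ⟨h1, h2⟩ := pi_sum_sq (stdGaussianVec (d m)) f hfL
      refine ⟨h1, h2.trans ?_⟩
      have h3 : ∀ k, ∫ g, (f k g) ^ 2 ∂(stdGaussianVec (d m)) ≤
          C4 * ((x ⬝ᵥ x / d m) ^ 2 + (y ⬝ᵥ y / d m) ^ 2) / 2 / (d m : ℝ) ^ 2 := by
        intro k
        simp only [hf]
        split_ifs
        · simp only [ne_eq, OfNat.ofNat_ne_zero, not_false_eq_true, zero_pow, integral_zero]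
          have := C4_nonneg
          positivity
        · simp_rw [div_pow ((_ : ℝ) * _)]
          rw [integral_div]
          gcongr
          exact dot_mul_sq_le x y
      refine (Finset.sum_le_sum fun k _ => h3 k).trans (le_of_eq ?_)
      simp
      field_simp
    refine TIP.cond (R := fun m p k => if k ∈ JJ (ι m) then p.1 k else p.2 k)
      (fun m => resample _ (JJ (ι m))) (fun m => ?_) (fun m v => (main m v).1)
      (fun m v => (main m v).2) ?_
    · exact (measurable_QQ _ _ _).sub ((measurable_vdot _ _).const_mul _)
    · have hr := tip_norm (n := n) hd1 hd (fun m => ι m r)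
      have hs := tip_norm (n := n) hd1 hd (fun m => ι m s)
      have hc : Tendsto (fun m => C4 / 2 * ((n m : ℝ) / (d m : ℝ) ^ 2) *
          ((1 / (d m : ℝ)) * (1 / d m))) atTop (𝓝 (C4 / 2 * α * (0 * 0))) :=
        (hlim.const_mul _).mul (h0.mul h0)
      have := (TIP.det (μ := fun m => Pn (d m) (n m)) hc).mul ((hr.mul hr).add (hs.mul hs))
      simpa only [mul_zero, zero_mul] using this
  have hc : Tendsto (fun m => ((n m : ℝ) - 3) / (d m : ℝ) ^ 2) atTop (𝓝 α) := by
    have := hlim.sub ((h0.mul h0).const_mul 3)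
    simp only [mul_zero, sub_zero] at this
    refine this.congr fun m => ?_
    have hdm : (0 : ℝ) < d m := by exact_mod_cast hd1 m
    field_simp
  have := key.add ((TIP.det (μ := fun m => Pn (d m) (n m)) hc).mul (tip_delta hd1 hd ι r s))
  have h2 : (0 : ℝ) + α * (if r = s then 1 else 0) = if r = s then α else 0 := by
    split_ifs <;> simp
  rw [h2] at this
  exact this.congr fun m v => by ring

end seqs

theorem score_eq {D N : ℕ} (u v : Fin N → Fin D → ℝ) (j i : Fin N) :
    scoreX u v j i = ∑ k, (u j ⬝ᵥ u k) * (v k ⬝ᵥ v i) := by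
  simp only [scoreX, Wcross, dotProduct, mulVec, Matrix.of_apply, Finset.sum_mul, Finset.mul_sum]
  rw [Finset.sum_comm]
  conv_lhs =>
    enter [2, b]
    rw [Finset.sum_comm]
  rw [Finset.sum_comm]
  refine Finset.sum_congr rfl fun k _ => Finset.sum_congr rfl fun b _ =>
    Finset.sum_congr rfl fun a _ => ?_
  ring

theorem measurable_fdot {D N : ℕ} (i j : Fin N) :
    Measurable (fun p : (Fin N → Fin D → ℝ) × (Fin N → Fin D → ℝ) => p.1 i ⬝ᵥ p.1 j) :=
  (measurable_vdot i j).comp measurable_fst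

theorem measurable_sdot {D N : ℕ} (i j : Fin N) :
    Measurable (fun p : (Fin N → Fin D → ℝ) × (Fin N → Fin D → ℝ) => p.2 i ⬝ᵥ p.2 j) :=
  (measurable_vdot i j).comp measurable_snd

theorem measurable_score {D N : ℕ} (j i : Fin N) :
    Measurable (fun p : (Fin N → Fin D → ℝ) × (Fin N → Fin D → ℝ) => scoreX p.1 p.2 j i) := by
  simp_rw [score_eq]
  exact Finset.measurable_sum _ fun k _ => (measurable_fdot _ _).mul (measurable_sdot _ _)

/-- Linear combination of two scores. -/
def TT {D N : ℕ} (e : Fin 3 ↪ Fin N) (a c : Fin 2 → Fin 3) (t : Fin 2 → ℝ)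
    (p : (Fin N → Fin D → ℝ) × (Fin N → Fin D → ℝ)) : ℝ :=
  ∑ r, t r * scoreX p.1 p.2 (e (a r)) (e (c r))

/-- Part of `TT` coming from the special indices. -/
def RR {D N : ℕ} (e : Fin 3 ↪ Fin N) (a c : Fin 2 → Fin 3) (t : Fin 2 → ℝ)
    (p : (Fin N → Fin D → ℝ) × (Fin N → Fin D → ℝ)) : ℝ :=
  ∑ r, t r * ∑ q, (p.1 (e (a r)) ⬝ᵥ p.1 (e q)) * (p.2 (e q) ⬝ᵥ p.2 (e (c r)))

/-- Coefficient vectors of the resampled coordinates. -/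
def ww {D N : ℕ} (e : Fin 3 ↪ Fin N) (a c : Fin 2 → Fin 3) (t : Fin 2 → ℝ)
    (p : (Fin N → Fin D → ℝ) × (Fin N → Fin D → ℝ)) (k : Fin N) : Fin D → ℝ :=
  if k ∈ JJ e then 0 else ∑ r, (t r * (p.2 k ⬝ᵥ p.2 (e (c r)))) • p.1 (e (a r))

/-- Conditional variance. -/
def HH {D N : ℕ} (e : Fin 3 ↪ Fin N) (a c : Fin 2 → Fin 3) (t : Fin 2 → ℝ)
    (p : (Fin N → Fin D → ℝ) × (Fin N → Fin D → ℝ)) : ℝ :=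
  ∑ r, ∑ s, (t r * t s) * ((p.1 (e (a r)) ⬝ᵥ p.1 (e (a s))) * QQ e (c r) (c s) p.2)

theorem HH_eq {D N : ℕ} (e : Fin 3 ↪ Fin N) (a c : Fin 2 → Fin 3) (t : Fin 2 → ℝ)
    (p : (Fin N → Fin D → ℝ) × (Fin N → Fin D → ℝ)) :
    HH e a c t p = ∑ k, (ww e a c t p k ⬝ᵥ ww e a c t p k) / D := by
  unfold HH QQ
  simp only [Finset.sum_div, Finset.mul_sum]
  conv_lhs =>
    enter [2, r]
    rw [Finset.sum_comm]
  rw [Finset.sum_comm]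
  refine Finset.sum_congr rfl fun k _ => ?_
  unfold ww
  by_cases hk : k ∈ JJ e
  · simp [hk]
  · simp only [hk, if_false, sum_dotProduct, dotProduct_sum, smul_dotProduct, dotProduct_smul,
      Finset.sum_div, smul_eq_mul]
    refine Finset.sum_congr rfl fun r _ => ?_
    rw [Finset.mul_sum, Finset.sum_div]
    refine Finset.sum_congr rfl fun s _ => ?_
    rw [dotProduct_comm (p.1 (e (a s)))]
    ring

theorem HH_nonneg {D N : ℕ} (e : Fin 3 ↪ Fin N) (a c : Fin 2 → Fin 3) (t : Fin 2 → ℝ)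
    (p : (Fin N → Fin D → ℝ) × (Fin N → Fin D → ℝ)) : 0 ≤ HH e a c t p := by
  rw [HH_eq]
  exact Finset.sum_nonneg fun k _ => div_nonneg (dot_self_nonneg _) (Nat.cast_nonneg _)

theorem TT_resample {D N : ℕ} (e : Fin 3 ↪ Fin N) (a c : Fin 2 → Fin 3) (t : Fin 2 → ℝ)
    (u u' v : Fin N → Fin D → ℝ) :
    TT e a c t (fun k => if k ∈ JJ e then u k else u' k, v) =
      RR e a c t (u, v) + ∑ k, u' k ⬝ᵥ ww e a c t (u, v) k := by
  have hsplit : ∀ f : Fin N → ℝ, ∑ k, f k = ∑ q, f (e q) + ∑ k, if k ∈ JJ e then 0 else f k := by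
    intro f
    have h1 : ∑ q, f (e q) = ∑ k, if k ∈ JJ e then f k else 0 := by
      rw [Finset.sum_ite_mem, Finset.univ_inter, JJ, Finset.sum_map]
    rw [h1, ← Finset.sum_add_distrib]
    refine Finset.sum_congr rfl fun k _ => ?_
    split_ifs <;> simp
  have hw : ∀ k, u' k ⬝ᵥ ww e a c t (u, v) k = ∑ r, if k ∈ JJ e then 0 else
      t r * ((u (e (a r)) ⬝ᵥ u' k) * (v k ⬝ᵥ v (e (c r)))) := by
    intro k
    unfold ww
    by_cases hk : k ∈ JJ e
    · simp [hk]
    · simp only [hk, if_false, dotProduct_sum, dotProduct_smul, smul_eq_mul]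
      refine Finset.sum_congr rfl fun r _ => ?_
      rw [dotProduct_comm (u' k)]; ring
  simp_rw [hw]
  rw [Finset.sum_comm]
  unfold TT RR
  rw [← Finset.sum_add_distrib]
  refine Finset.sum_congr rfl fun r _ => ?_
  rw [score_eq, hsplit]
  simp only [mem_JJ, if_true, mul_add, Finset.mul_sum]
  congr 1
  refine Finset.sum_congr rfl fun k _ => ?_
  by_cases hk : k ∈ JJ e
  · simp [hk]
  · simp [hk]

theorem measurable_TT {D N : ℕ} (e : Fin 3 ↪ Fin N) (a c : Fin 2 → Fin 3) (t : Fin 2 → ℝ) :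
    Measurable (TT (D := D) e a c t) :=
  Finset.measurable_sum _ fun _ _ => (measurable_score _ _).const_mul _

theorem measurable_RR {D N : ℕ} (e : Fin 3 ↪ Fin N) (a c : Fin 2 → Fin 3) (t : Fin 2 → ℝ) :
    Measurable (RR (D := D) e a c t) :=
  Finset.measurable_sum _ fun _ _ => (Finset.measurable_sum _ fun _ _ =>
    (measurable_fdot _ _).mul (measurable_sdot _ _)).const_mul _

theorem measurable_HH {D N : ℕ} (e : Fin 3 ↪ Fin N) (a c : Fin 2 → Fin 3) (t : Fin 2 → ℝ) :
    Measurable (HH (D := D) e a c t) :=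
  Finset.measurable_sum _ fun _ _ => Finset.measurable_sum _ fun _ _ =>
    ((measurable_fdot _ _).mul ((measurable_QQ _ _ _).comp measurable_snd)).const_mul _

theorem norm_exp_RH (x h : ℝ) (hh : 0 ≤ h) :
    ‖Complex.exp ((x : ℂ) * Complex.I + ((-h / 2 : ℝ) : ℂ))‖ ≤ 1 := by
  rw [Complex.norm_exp]
  simp
  linarith

theorem integral_TT {D N : ℕ} (e : Fin 3 ↪ Fin N) (a c : Fin 2 → Fin 3) (t : Fin 2 → ℝ) :
    ∫ p, Complex.exp ((TT e a c t p : ℂ) * Complex.I) ∂(gaussianModel D N) =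
      ∫ p, Complex.exp ((RR e a c t p : ℂ) * Complex.I + ((-HH e a c t p / 2 : ℝ) : ℂ))
        ∂(gaussianModel D N) := by
  have hG : gaussianModel D N = (Pn D N).prod (Pn D N) := rfl
  rw [hG]
  have hmT : Measurable (fun p : (Fin N → Fin D → ℝ) × (Fin N → Fin D → ℝ) =>
      Complex.exp ((TT e a c t p : ℂ) * Complex.I)) := by
    have := measurable_TT (D := D) e a c t
    fun_prop
  have hmR : Measurable (fun p : (Fin N → Fin D → ℝ) × (Fin N → Fin D → ℝ) =>
      Complex.exp ((RR e a c t p : ℂ) * Complex.I + ((-HH e a c t p / 2 : ℝ) : ℂ))) := by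
    have h1 := measurable_RR (D := D) e a c t
    have h2 := measurable_HH (D := D) e a c t
    fun_prop
  rw [integral_prod_symm _ (Integrable.of_bound hmT.aestronglyMeasurable 1
      (ae_of_all _ fun p => (Complex.norm_exp_ofReal_mul_I _).le)),
    integral_prod_symm _ (Integrable.of_bound hmR.aestronglyMeasurable 1
      (ae_of_all _ fun p => norm_exp_RH _ _ (HH_nonneg _ _ _ _ _)))]
  refine integral_congr_ae (ae_of_all _ fun v => ?_)
  dsimp only
  have hres : MeasurePreserving (fun p : (Fin N → Fin D → ℝ) × (Fin N → Fin D → ℝ) =>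
      fun k => if k ∈ JJ e then p.1 k else p.2 k) ((Pn D N).prod (Pn D N)) (Pn D N) :=
    resample (stdGaussianVec D) (JJ e)
  have hmTv : Measurable (fun u : (Fin N → Fin D → ℝ) =>
      Complex.exp ((TT e a c t (u, v) : ℂ) * Complex.I)) :=
    hmT.comp (measurable_id.prodMk measurable_const)
  conv_lhs => rw [← hres.map_eq]
  rw [integral_map hres.measurable.aemeasurable hmTv.aestronglyMeasurable,
    integral_prod (fun x : (Fin N → Fin D → ℝ) × (Fin N → Fin D → ℝ) =>
      Complex.exp ((TT e a c t (fun k => if k ∈ JJ e then x.1 k else x.2 k, v) : ℂ) * Complex.I))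
      (Integrable.of_bound (hmTv.comp hres.measurable).aestronglyMeasurable 1
      (ae_of_all _ fun p => (Complex.norm_exp_ofReal_mul_I _).le))]
  refine integral_congr_ae (ae_of_all _ fun u => ?_)
  dsimp only
  simp_rw [TT_resample]
  have h1 : ∀ u' : Fin N → Fin D → ℝ,
      Complex.exp (((RR e a c t (u, v) + ∑ k, u' k ⬝ᵥ ww e a c t (u, v) k : ℝ) : ℂ) * Complex.I)
      = Complex.exp ((RR e a c t (u, v) : ℂ) * Complex.I) *
        ∏ k, Complex.exp (((u' k ⬝ᵥ ww e a c t (u, v) k : ℝ) : ℂ) * Complex.I) := by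
    intro u'
    rw [← Complex.exp_sum, ← Complex.exp_add]
    congr 1
    push_cast
    rw [add_mul, Finset.sum_mul]
  simp_rw [h1]
  rw [integral_const_mul]
  unfold Pn
  rw [integral_fintype_prod_eq_prod (f := fun k (g : Fin D → ℝ) =>
    Complex.exp (((g ⬝ᵥ ww e a c t (u, v) k : ℝ) : ℂ) * Complex.I))]
  simp_rw [integral_exp_dot]
  rw [← Complex.exp_sum, ← Complex.exp_add]
  congr 2
  rw [HH_eq, ← Complex.ofReal_sum]
  congr 1
  rw [← Finset.sum_neg_distrib, Finset.sum_div]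
  exact Finset.sum_congr rfl fun k _ => by ring

section seqs2

variable {n d : ℕ → ℕ}

theorem charfun_limit (hd1 : ∀ m, 1 ≤ d m) (hd : Tendsto d atTop atTop)
    {α : ℝ} (hlim : Tendsto (fun m => (n m : ℝ) / (d m : ℝ) ^ 2) atTop (𝓝 α))
    (ι : ∀ m, Fin 3 ↪ Fin (n m)) (a c : Fin 2 → Fin 3) (ha : Function.Injective a)
    (t : Fin 2 → ℝ) :
    Tendsto (fun m => ∫ p, Complex.exp ((TT (ι m) a c t p : ℂ) * Complex.I)
        ∂(gaussianModel (d m) (n m))) atTop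
      (𝓝 (Complex.exp (((∑ r, t r * (if a r = c r then 1 else 0) : ℝ) : ℂ) * Complex.I +
        ((-(∑ r, t r ^ 2 * α) / 2 : ℝ) : ℂ)))) := by
  simp_rw [integral_TT]
  set μ := fun m => gaussianModel (d m) (n m) with hμ
  have hfst : ∀ m, MeasurePreserving Prod.fst (μ m) (Pn (d m) (n m)) := fun m =>
    measurePreserving_fst (μ := Pn (d m) (n m)) (ν := Pn (d m) (n m))
  have hsnd : ∀ m, MeasurePreserving Prod.snd (μ m) (Pn (d m) (n m)) := fun m =>
    measurePreserving_snd (μ := Pn (d m) (n m)) (ν := Pn (d m) (n m))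
  have hu := fun r s => (tip_delta hd1 hd ι r s).map hfst
  have hv := fun r s => (tip_delta hd1 hd ι r s).map hsnd
  have hQ := fun r s => (tip_QQ hd1 hd hlim ι r s).map hsnd
  have hc : ∀ b : ℝ, TIP μ (fun _ _ => b) b := fun b => TIP.det tendsto_const_nhds
  have hR : TIP μ (fun m p => RR (ι m) a c t p)
      (∑ r, t r * (if a r = c r then 1 else 0)) := by
    have := TIP.sum (μ := μ) Finset.univ (fun r _ => (hc (t r)).mul
      (TIP.sum (μ := μ) Finset.univ fun q _ => (hu (a r) q).mul (hv q (c r))))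
    simpa [RR] using this
  have hH : TIP μ (fun m p => HH (ι m) a c t p) (∑ r, t r ^ 2 * α) := by
    have := TIP.sum (μ := μ) Finset.univ (fun r _ => TIP.sum (μ := μ) Finset.univ fun s _ =>
      (hc (t r * t s)).mul ((hu (a r) (a s)).mul (hQ (c r) (c s))))
    simpa [HH, ha.eq_iff, sq] using this
  have hRH := (hR.prodMk hH).comp (f := fun q : ℝ × ℝ =>
    Complex.exp ((q.1 : ℂ) * Complex.I + ((-q.2 / 2 : ℝ) : ℂ))) (by fun_prop)
  refine hRH.integral (fun m => ?_) (fun m p => norm_exp_RH _ _ (HH_nonneg _ _ _ _ _))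
  have h1 := measurable_RR (D := d m) (ι m) a c t
  have h2 := measurable_HH (D := d m) (ι m) a c t
  fun_prop

theorem weak_limit (hd1 : ∀ m, 1 ≤ d m) (hd : Tendsto d atTop atTop)
    {α : ℝ} (hα : 0 < α) (hlim : Tendsto (fun m => (n m : ℝ) / (d m : ℝ) ^ 2) atTop (𝓝 α))
    (ι : ∀ m, Fin 3 ↪ Fin (n m)) (a c : Fin 2 → Fin 3) (ha : Function.Injective a)
    {E : Set (ℝ × ℝ)} (hE : MeasurableSet E)
    (hE0 : ((gaussianReal (if a 0 = c 0 then 1 else 0) α.toNNReal).prod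
      (gaussianReal (if a 1 = c 1 then 1 else 0) α.toNNReal)) (frontier E) = 0) :
    Tendsto (fun m => gaussianModel (d m) (n m) {p |
        (scoreX p.1 p.2 (ι m (a 0)) (ι m (c 0)), scoreX p.1 p.2 (ι m (a 1)) (ι m (c 1))) ∈ E})
      atTop (𝓝 (((gaussianReal (if a 0 = c 0 then 1 else 0) α.toNNReal).prod
      (gaussianReal (if a 1 = c 1 then 1 else 0) α.toNNReal)) E)) := by
  set ν := (gaussianReal (if a 0 = c 0 then 1 else 0) α.toNNReal).prod
      (gaussianReal (if a 1 = c 1 then 1 else 0) α.toNNReal) with hν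
  set S : ∀ m, (Fin (n m) → Fin (d m) → ℝ) × (Fin (n m) → Fin (d m) → ℝ) → ℝ × ℝ := fun m p =>
    (scoreX p.1 p.2 (ι m (a 0)) (ι m (c 0)), scoreX p.1 p.2 (ι m (a 1)) (ι m (c 1))) with hS
  have hSm : ∀ m, Measurable (S m) := fun m => (measurable_score _ _).prodMk (measurable_score _ _)
  have hL : Measurable (WithLp.toLp 2 : ℝ × ℝ → WithLp 2 (ℝ × ℝ)) :=
    (MeasurableEquiv.toLp 2 (ℝ × ℝ)).measurable
  set ρ : ℕ → ProbabilityMeasure (WithLp 2 (ℝ × ℝ)) := fun m =>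
    ⟨((gaussianModel (d m) (n m)).map (S m)).map (WithLp.toLp 2), by
      have := Measure.isProbabilityMeasure_map (μ := gaussianModel (d m) (n m))
        (hSm m).aemeasurable
      exact Measure.isProbabilityMeasure_map hL.aemeasurable⟩ with hρ
  set ρ0 : ProbabilityMeasure (WithLp 2 (ℝ × ℝ)) :=
    ⟨ν.map (WithLp.toLp 2), Measure.isProbabilityMeasure_map hL.aemeasurable⟩ with hρ0
  have hw : Tendsto ρ atTop (𝓝 ρ0) := by
    refine ProbabilityMeasure.tendsto_of_tendsto_charFun fun t => ?_
    have h1 := charfun_limit hd1 hd hlim ι a c ha ![t.fst, t.snd]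
    have e0 : charFun (ρ0 : Measure (WithLp 2 (ℝ × ℝ))) t =
        Complex.exp (((∑ r, ![t.fst, t.snd] r * (if a r = c r then 1 else 0) : ℝ) : ℂ) * Complex.I +
        ((-(∑ r, ![t.fst, t.snd] r ^ 2 * α) / 2 : ℝ) : ℂ)) := by
      change charFun (ν.map (WithLp.toLp 2)) t = _
      rw [hν, charFun_prod, charFun_gaussianReal, charFun_gaussianReal, ← Complex.exp_add]
      congr 1
      have hα' : ((α.toNNReal : NNReal) : ℂ) = (α : ℂ) := by
        rw [← Real.coe_toNNReal α hα.le]; simp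
      rw [hα']
      simp only [Fin.sum_univ_two, Matrix.cons_val_zero, Matrix.cons_val_one]
      push_cast
      simp only [WithLp.ofLp_fst, WithLp.ofLp_snd]
      ring
    rw [e0]
    refine h1.congr fun m => ?_
    change _ = charFun (((gaussianModel (d m) (n m)).map (S m)).map (WithLp.toLp 2)) t
    rw [charFun_apply, integral_map hL.aemeasurable (by fun_prop),
      integral_map (hSm m).aemeasurable]
    · refine integral_congr_ae (ae_of_all _ fun p => ?_)
      simp only [TT, Fin.sum_univ_two, hS, WithLp.prod_inner_apply]
      simp
    · refine Measurable.aestronglyMeasurable ?_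
      have : Measurable fun x : ℝ × ℝ => (WithLp.toLp 2 x : WithLp 2 (ℝ × ℝ)) := hL
      fun_prop
  have hcont : Continuous (WithLp.ofLp : WithLp 2 (ℝ × ℝ) → ℝ × ℝ) :=
    WithLp.prod_continuous_ofLp 2 ℝ ℝ
  have hw2 := ProbabilityMeasure.tendsto_map_of_tendsto_of_continuous ρ ρ0 hw hcont
  have e2 : ∀ η : Measure (ℝ × ℝ), (η.map (WithLp.toLp 2)).map
      (WithLp.ofLp : WithLp 2 (ℝ × ℝ) → ℝ × ℝ) = η := by
    intro η
    rw [Measure.map_map hcont.measurable hL]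
    exact Measure.map_id
  have e3 : ((ρ0.map hcont.measurable.aemeasurable : ProbabilityMeasure (ℝ × ℝ)) :
      Measure (ℝ × ℝ)) = ν := e2 ν
  have hfin := ProbabilityMeasure.tendsto_measure_of_null_frontier_of_tendsto' hw2 (E := E)
    (by rw [e3]; exact hE0)
  rw [e3] at hfin
  refine hfin.congr fun m => ?_
  have e4 : (((ρ m).map hcont.measurable.aemeasurable : ProbabilityMeasure (ℝ × ℝ)) :
      Measure (ℝ × ℝ)) = (gaussianModel (d m) (n m)).map (S m) := e2 _
  rw [e4, Measure.map_apply (hSm m) hE]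
  rfl

theorem pair_limit (hd1 : ∀ m, 1 ≤ d m) (hd : Tendsto d atTop atTop)
    {α : ℝ} (hα : 0 < α) (hlim : Tendsto (fun m => (n m : ℝ) / (d m : ℝ) ^ 2) atTop (𝓝 α))
    (ι : ∀ m, Fin 3 ↪ Fin (n m)) (a c : Fin 2 → Fin 3) (ha : Function.Injective a) (x y : ℝ) :
    Tendsto (fun m => (gaussianModel (d m) (n m)).real {p |
        scoreX p.1 p.2 (ι m (a 0)) (ι m (c 0)) ≤ x ∧ scoreX p.1 p.2 (ι m (a 1)) (ι m (c 1)) ≤ y})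
      atTop (𝓝 ((gaussianReal (if a 0 = c 0 then 1 else 0) α.toNNReal).real (Set.Iic x) *
      (gaussianReal (if a 1 = c 1 then 1 else 0) α.toNNReal).real (Set.Iic y))) := by
  have hα' : α.toNNReal ≠ 0 := by simpa using hα
  have := nullSingletonClass_gaussianReal (μ := if a 0 = c 0 then 1 else 0) hα'
  have := nullSingletonClass_gaussianReal (μ := if a 1 = c 1 then 1 else 0) hα'
  have h := weak_limit hd1 hd hα hlim ι a c ha (E := Set.Iic x ×ˢ Set.Iic y)
    (measurableSet_Iic.prod measurableSet_Iic) (by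
      rw [frontier_prod_eq, frontier_Iic, frontier_Iic]
      refine measure_mono_null (t := (Set.univ ×ˢ {y}) ∪ ({x} ×ˢ Set.univ)) ?_ ?_
      · gcongr <;> simp
      · refine measure_union_null ?_ ?_ <;> rw [Measure.prod_prod] <;> simp)
  rw [Measure.prod_prod] at h
  have h2 := (ENNReal.tendsto_toReal (by finiteness)).comp h
  rw [ENNReal.toReal_mul] at h2
  exact h2

theorem single_limit (hd1 : ∀ m, 1 ≤ d m) (hd : Tendsto d atTop atTop)
    {α : ℝ} (hα : 0 < α) (hlim : Tendsto (fun m => (n m : ℝ) / (d m : ℝ) ^ 2) atTop (𝓝 α))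
    (ι : ∀ m, Fin 3 ↪ Fin (n m)) (a c : Fin 2 → Fin 3) (ha : Function.Injective a) (x : ℝ) :
    Tendsto (fun m => (gaussianModel (d m) (n m)).real {p |
        scoreX p.1 p.2 (ι m (a 0)) (ι m (c 0)) ≤ x})
      atTop (𝓝 ((gaussianReal (if a 0 = c 0 then 1 else 0) α.toNNReal).real (Set.Iic x))) := by
  have hα' : α.toNNReal ≠ 0 := by simpa using hα
  have := nullSingletonClass_gaussianReal (μ := if a 0 = c 0 then 1 else 0) hα'
  have h := weak_limit hd1 hd hα hlim ι a c ha (E := Set.Iic x ×ˢ Set.univ)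
    (measurableSet_Iic.prod MeasurableSet.univ) (by
      rw [frontier_prod_eq, frontier_Iic]
      simp)
  rw [Measure.prod_prod] at h
  have h2 := (ENNReal.tendsto_toReal (by finiteness)).comp h
  rw [ENNReal.toReal_mul] at h2
  simpa [Function.comp_def, Measure.real] using h2

end seqs2

section phi

theorem gcdf_strictMono (a : ℝ) {v : NNReal} (hv : v ≠ 0) :
    StrictMono fun x => (gaussianReal a v).real (Set.Iic x) := by
  intro x y hxy
  have h1 : (gaussianReal a v).real (Set.Iic y) =
      (gaussianReal a v).real (Set.Iic x) + (gaussianReal a v).real (Set.Ioc x y) := by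
    rw [← measureReal_union _ measurableSet_Ioc, Set.Iic_union_Ioc_eq_Iic hxy.le]
    exact Set.Iic_disjoint_Ioc le_rfl
  have h2 : 0 < (gaussianReal a v).real (Set.Ioc x y) := by
    rw [measureReal_def]
    refine ENNReal.toReal_pos (fun h => ?_) (by finiteness)
    have := gaussianReal_absolutelyContinuous' a hv h
    simp at this
    linarith
  show (gaussianReal a v).real (Set.Iic x) < (gaussianReal a v).real (Set.Iic y)
  linarith

theorem gcdf_continuous (a : ℝ) {v : NNReal} (hv : v ≠ 0) :
    Continuous fun x => (gaussianReal a v).real (Set.Iic x) := by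
  have e : (fun x => (gaussianReal a v).real (Set.Iic x)) = cdf (gaussianReal a v) := by
    ext x; rw [cdf_eq_real]
  rw [e, continuous_iff_continuousAt]
  intro x
  rw [(monotone_cdf _).continuousAt_iff_leftLim_eq_rightLim, StieltjesFunction.rightLim_eq]
  have := nullSingletonClass_gaussianReal (μ := a) hv
  have h := (cdf (gaussianReal a v)).measure_singleton x
  rw [measure_cdf, measure_singleton] at h
  have h2 := (monotone_cdf (gaussianReal a v)).leftLim_le (le_refl x)
  have h3 := ENNReal.ofReal_eq_zero.mp h.symm
  linarith

theorem gcdf_eq_Phi (a : ℝ) {α : ℝ} (hα : 0 < α) (x : ℝ) :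
    (gaussianReal a α.toNNReal).real (Set.Iic x) = Phi ((x - a) / √α) := by
  have h1 : gaussianReal a α.toNNReal = ((gaussianReal 0 1).map (√α * ·)).map (· + a) := by
    rw [gaussianReal_map_const_mul, gaussianReal_map_add_const]
    congr 1
    · simp
    · ext; simp [Real.sq_sqrt hα.le, hα.le]
  have hs : 0 < √α := Real.sqrt_pos.mpr hα
  rw [h1, measureReal_def, Measure.map_apply (by fun_prop) measurableSet_Iic,
    Measure.map_apply (by fun_prop) (measurableSet_Iic.preimage (by fun_prop)), Phi]
  congr 2
  ext y
  simp only [Set.mem_preimage, Set.mem_Iic]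
  rw [le_div_iff₀ hs]
  constructor <;> intro h <;> linarith

theorem Phi_strictMono : StrictMono Phi := gcdf_strictMono 0 one_ne_zero
theorem Phi_continuous : Continuous Phi := gcdf_continuous 0 one_ne_zero

theorem Phi_atBot : Tendsto Phi atBot (𝓝 0) := by
  have e : Phi = cdf (gaussianReal 0 1) := by
    ext x; rw [cdf_eq_real]; rfl
  rw [e]; exact tendsto_cdf_atBot _

theorem Phi_atTop : Tendsto Phi atTop (𝓝 1) := by
  have e : Phi = cdf (gaussianReal 0 1) := by
    ext x; rw [cdf_eq_real]; rfl
  rw [e]; exact tendsto_cdf_atTop _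

theorem PhiInv_Phi (x : ℝ) : PhiInv (Phi x) = x := by
  have : {y : ℝ | Phi x ≤ Phi y} = Set.Ici x := by
    ext y; exact Phi_strictMono.le_iff_le
  rw [PhiInv, this, csInf_Ici]

theorem Phi_pos (x : ℝ) : 0 < Phi x :=
  lt_of_le_of_lt ENNReal.toReal_nonneg (Phi_strictMono (sub_one_lt x))

theorem Phi_lt_one (x : ℝ) : Phi x < 1 :=
  lt_of_lt_of_le (Phi_strictMono (lt_add_one x))
    (measureReal_le_one (μ := gaussianReal 0 1))

theorem exists_Phi {w : ℝ} (h0 : 0 < w) (h1 : w < 1) : ∃ x, Phi x = w := by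
  obtain ⟨a, ha⟩ := (Phi_atBot.eventually (gt_mem_nhds h0)).exists
  obtain ⟨b, hb⟩ := (Phi_atTop.eventually (lt_mem_nhds h1)).exists
  exact mem_range_of_exists_le_of_exists_ge Phi_continuous ⟨a, ha.le⟩ ⟨b, hb.le⟩

end phi

theorem uniform_of_select {n : ℕ → ℕ} (h3 : ∀ m, 3 ≤ n m)
    (f : ∀ m, (Fin 3 ↪ Fin (n m)) → ℝ) (L : ℝ)
    (h : ∀ ι : ∀ m, Fin 3 ↪ Fin (n m), Tendsto (fun m => f m (ι m)) atTop (𝓝 L))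
    {ε : ℝ} (hε : 0 < ε) : ∀ᶠ m in atTop, ∀ e, |f m e - L| < ε := by
  classical
  have : ∀ m, ∃ e : Fin 3 ↪ Fin (n m), (∃ e', ¬ |f m e' - L| < ε) → ¬ |f m e - L| < ε := by
    intro m
    by_cases hb : ∃ e', ¬ |f m e' - L| < ε
    · obtain ⟨e, he⟩ := hb
      exact ⟨e, fun _ => he⟩
    · exact ⟨(Fin.castLEEmb (h3 m)), fun h => absurd h hb⟩
  choose ι hι using this
  have h1 := h ι
  rw [Metric.tendsto_nhds] at h1
  filter_upwards [h1 ε hε] with m hm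
  intro e
  by_contra hc
  exact hι m ⟨e, hc⟩ (by simpa [Real.dist_eq] using hm)

theorem exists_emb3 {N : ℕ} (i j k : Fin N) (hij : i ≠ j) (hik : i ≠ k) (hjk : j ≠ k) :
    ∃ e : Fin 3 ↪ Fin N, e 0 = i ∧ e 1 = j ∧ e 2 = k := by
  refine ⟨⟨![i, j, k], ?_⟩, rfl, rfl, rfl⟩
  intro a b h
  fin_cases a <;> fin_cases b <;> simp_all

theorem exists_emb2 {N : ℕ} (hN : 3 ≤ N) (i j : Fin N) (hij : i ≠ j) :
    ∃ e : Fin 3 ↪ Fin N, e 0 = i ∧ e 1 = j := by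
  obtain ⟨k, hk⟩ : ∃ k, k ∉ ({i, j} : Finset (Fin N)) := by
    by_contra! hc
    have : (Finset.univ : Finset (Fin N)) ⊆ {i, j} := fun x _ => hc x
    have := Finset.card_le_card this
    have h2 : ({i, j} : Finset (Fin N)).card ≤ 2 := Finset.card_le_two
    simp at this
    omega
  simp at hk
  obtain ⟨e, h0, h1, -⟩ := exists_emb3 i j k hij (Ne.symm hk.1) (Ne.symm hk.2)
  exact ⟨e, h0, h1⟩

theorem exists_emb1 {N : ℕ} (hN : 3 ≤ N) (i : Fin N) :
    ∃ e : Fin 3 ↪ Fin N, e 0 = i := by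
  have : Nontrivial (Fin N) := Fin.nontrivial_iff_two_le.mpr (by omega)
  obtain ⟨j, hj⟩ := exists_ne i
  obtain ⟨e, h0, -⟩ := exists_emb2 hN i j hj.symm
  exact ⟨e, h0⟩

theorem second_moment_avg {Ω κ : Type} [MeasurableSpace Ω] (μ : Measure Ω) [IsProbabilityMeasure μ]
    [DecidableEq κ] (K : Finset κ) (hK : 0 < K.card) (B : κ → Set Ω)
    (hB : ∀ k ∈ K, MeasurableSet (B k)) (c : ℝ) (hc0 : 0 ≤ c) (hc1 : c ≤ 1) {ε : ℝ} (hε : 0 ≤ ε)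
    (h1 : ∀ k ∈ K, |μ.real (B k) - c| ≤ ε)
    (h2 : ∀ k ∈ K, ∀ l ∈ K, k ≠ l → |μ.real (B k ∩ B l) - c ^ 2| ≤ ε) :
    Integrable (fun ω => ((∑ k ∈ K, (B k).indicator (fun _ => (1 : ℝ)) ω) / K.card - c) ^ 2) μ ∧
    ∫ ω, ((∑ k ∈ K, (B k).indicator (fun _ => (1 : ℝ)) ω) / K.card - c) ^ 2 ∂μ
      ≤ 3 * ε + 1 / K.card := by
  have hN : (0 : ℝ) < K.card := by exact_mod_cast hK
  have hexp : ∀ ω, ((∑ k ∈ K, (B k).indicator (fun _ => (1 : ℝ)) ω) / K.card - c) ^ 2 =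
      (∑ k ∈ K, ∑ l ∈ K, ((B k ∩ B l).indicator (fun _ => (1 : ℝ)) ω
        - c * (B k).indicator (fun _ => (1 : ℝ)) ω - c * (B l).indicator (fun _ => (1 : ℝ)) ω
        + c ^ 2)) / (K.card : ℝ) ^ 2 := by
    intro ω
    have : ∀ k l, ((B k ∩ B l).indicator (fun _ => (1 : ℝ)) ω
        - c * (B k).indicator (fun _ => (1 : ℝ)) ω - c * (B l).indicator (fun _ => (1 : ℝ)) ω
        + c ^ 2) = ((B k).indicator (fun _ => (1 : ℝ)) ω - c) *
          ((B l).indicator (fun _ => (1 : ℝ)) ω - c) := by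
      intro k l
      by_cases ha : ω ∈ B k <;> by_cases hb : ω ∈ B l <;> simp [ha, hb] <;> ring
    simp_rw [this, ← Finset.mul_sum, ← Finset.sum_mul, Finset.sum_sub_distrib]
    simp only [Finset.sum_const, nsmul_eq_mul]
    field_simp
  have hI : ∀ s, MeasurableSet s → Integrable (s.indicator (fun _ => (1 : ℝ))) μ := fun s hs =>
    (integrable_const 1).indicator hs
  have hterm : ∀ k ∈ K, ∀ l ∈ K, Integrable (fun ω => (B k ∩ B l).indicator (fun _ => (1 : ℝ)) ω
        - c * (B k).indicator (fun _ => (1 : ℝ)) ω - c * (B l).indicator (fun _ => (1 : ℝ)) ω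
        + c ^ 2) μ := fun k hk l hl =>
    ((((hI _ ((hB k hk).inter (hB l hl))).sub ((hI _ (hB k hk)).const_mul c)).sub
      ((hI _ (hB l hl)).const_mul c)).add (integrable_const _))
  have hval : ∀ k ∈ K, ∀ l ∈ K, ∫ ω, ((B k ∩ B l).indicator (fun _ => (1 : ℝ)) ω
        - c * (B k).indicator (fun _ => (1 : ℝ)) ω - c * (B l).indicator (fun _ => (1 : ℝ)) ω
        + c ^ 2) ∂μ = μ.real (B k ∩ B l) - c * μ.real (B k) - c * μ.real (B l) + c ^ 2 := by
    intro k hk l hl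
    have i1 := hI _ ((hB k hk).inter (hB l hl))
    have i2 := (hI _ (hB k hk)).const_mul c
    have i3 := (hI _ (hB l hl)).const_mul c
    have e1 := integral_add ((i1.sub i2).sub i3) (integrable_const (c ^ 2))
    have e2 := integral_sub (i1.sub i2) i3
    have e3 := integral_sub i1 i2
    simp only [Pi.sub_apply, Pi.add_apply] at e1 e2 e3
    rw [e1, e2, e3, integral_const_mul, integral_const_mul,
      integral_indicator_const _ ((hB k hk).inter (hB l hl)),
      integral_indicator_const _ (hB k hk), integral_indicator_const _ (hB l hl)]
    simp
  simp_rw [hexp]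
  constructor
  · exact (integrable_finsetSum _ fun k hk => integrable_finsetSum _ fun l hl =>
      hterm k hk l hl).div_const _
  rw [integral_div, integral_finsetSum _ fun k hk => integrable_finsetSum _ fun l hl =>
      hterm k hk l hl]
  have hb : ∀ k ∈ K, ∀ l ∈ K, ∫ ω, ((B k ∩ B l).indicator (fun _ => (1 : ℝ)) ω
        - c * (B k).indicator (fun _ => (1 : ℝ)) ω - c * (B l).indicator (fun _ => (1 : ℝ)) ω
        + c ^ 2) ∂μ ≤ 3 * ε + if k = l then 1 else 0 := by
    intro k hk l hl
    rw [hval k hk l hl]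
    have a1 := abs_le.mp (h1 k hk)
    have a2 := abs_le.mp (h1 l hl)
    have b1 : c * c - c * μ.real (B k) ≤ ε := by nlinarith
    have b2 : c * c - c * μ.real (B l) ≤ ε := by nlinarith
    split_ifs with hkl
    · have : μ.real (B k ∩ B l) ≤ 1 := measureReal_le_one
      nlinarith
    · have a3 := abs_le.mp (h2 k hk l hl hkl)
      nlinarith
  calc _ ≤ (∑ k ∈ K, ∑ l ∈ K, (3 * ε + if k = l then 1 else 0)) / (K.card : ℝ) ^ 2 := by
        gcongr with k hk
        rw [integral_finsetSum _ fun l hl => hterm k hk l hl]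
        exact Finset.sum_le_sum fun l hl => hb k hk l hl
    _ = 3 * ε + 1 / K.card := by
        simp only [Finset.sum_add_distrib, Finset.sum_ite_eq, Finset.sum_const, nsmul_eq_mul]
        rw [Finset.sum_ite_mem]
        simp
        field_simp

theorem avg_tip {Ω : ℕ → Type} [∀ m, MeasurableSpace (Ω m)] {μ : ∀ m, Measure (Ω m)}
    [∀ m, IsProbabilityMeasure (μ m)] {κ : ℕ → Type} [∀ m, DecidableEq (κ m)]
    (K : ∀ m, Finset (κ m)) (hK : Tendsto (fun m => (K m).card) atTop atTop)
    (B : ∀ m, κ m → Set (Ω m)) (hB : ∀ m, ∀ k ∈ K m, MeasurableSet (B m k))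
    (c : ℝ) (hc0 : 0 ≤ c) (hc1 : c ≤ 1)
    (h1 : ∀ ε > 0, ∀ᶠ m in atTop, ∀ k ∈ K m, |(μ m).real (B m k) - c| ≤ ε)
    (h2 : ∀ ε > 0, ∀ᶠ m in atTop, ∀ k ∈ K m, ∀ l ∈ K m, k ≠ l →
      |(μ m).real (B m k ∩ B m l) - c ^ 2| ≤ ε) :
    TIP μ (fun m ω => (∑ k ∈ K m, (B m k).indicator (fun _ => (1 : ℝ)) ω) / (K m).card) c := by
  refine TIP.of_abs fun δ hδ => ?_
  have key : ∀ ε > 0, ∀ᶠ m in atTop, (μ m).real {ω | δ ≤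
      |(∑ k ∈ K m, (B m k).indicator (fun _ => (1 : ℝ)) ω) / (K m).card - c|} < ε := by
    intro ε hε
    have hη : 0 < δ ^ 2 * ε / 8 := by positivity
    have hinv : Tendsto (fun m => 1 / ((K m).card : ℝ)) atTop (𝓝 0) :=
      tendsto_one_div_atTop_nhds_zero_nat.comp hK
    filter_upwards [h1 _ hη, h2 _ hη, hK.eventually_ge_atTop 1,
      hinv.eventually (gt_mem_nhds hη)] with m a1 a2 a3 a4
    obtain ⟨hi, hb⟩ := second_moment_avg (μ m) (K m) a3 (B m) (hB m) c hc0 hc1 hη.le a1 a2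
    have hm := mul_meas_ge_le_integral_of_nonneg (μ := μ m)
      (Eventually.of_forall fun ω => sq_nonneg _) hi (δ ^ 2)
    have hs : {ω | δ ≤ |(∑ k ∈ K m, (B m k).indicator (fun _ => (1 : ℝ)) ω) / (K m).card - c|} ⊆
        {ω | δ ^ 2 ≤ ((∑ k ∈ K m, (B m k).indicator (fun _ => (1 : ℝ)) ω) / (K m).card - c) ^ 2} := by
      intro ω hω
      simp only [Set.mem_ofPred_eq] at hω ⊢
      rw [← sq_abs (_ - c)]
      gcongr
    have hm2 := measureReal_mono (μ := μ m) hs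
    have hδ2 : 0 < δ ^ 2 := by positivity
    have : δ ^ 2 * (μ m).real {ω | δ ≤
      |(∑ k ∈ K m, (B m k).indicator (fun _ => (1 : ℝ)) ω) / (K m).card - c|} < δ ^ 2 * ε := by
      calc _ ≤ _ := mul_le_mul_of_nonneg_left hm2 hδ2.le
        _ ≤ _ := hm
        _ ≤ _ := hb
        _ < _ := by linarith [show 0 < δ ^ 2 * ε by positivity]
    exact lt_of_mul_lt_mul_left this hδ2.le
  have hr : Tendsto (fun m => (μ m).real {ω | δ ≤
      |(∑ k ∈ K m, (B m k).indicator (fun _ => (1 : ℝ)) ω) / (K m).card - c|}) atTop (𝓝 0) := by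
    rw [Metric.tendsto_nhds]
    intro ε hε
    filter_upwards [key ε hε] with m hm
    rw [Real.dist_eq, sub_zero, abs_of_nonneg measureReal_nonneg]
    exact hm
  have := ENNReal.tendsto_ofReal hr
  simpa [Measure.real, ENNReal.ofReal_toReal] using this

section fin
variable {n d : ℕ → ℕ}

/-- The empirical CDF of the off-diagonal scores in column `i`. -/
def GG {D N : ℕ} (p : (Fin N → Fin D → ℝ) × (Fin N → Fin D → ℝ)) (i : Fin N) (x : ℝ) : ℝ :=
  (∑ j ∈ Finset.univ.erase i, if scoreX p.1 p.2 j i ≤ x then (1 : ℝ) else 0) / ((N : ℝ) - 1)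

theorem percentile_eq {D N : ℕ} (p : (Fin N → Fin D → ℝ) × (Fin N → Fin D → ℝ)) (i : Fin N) :
    percentile p i = GG p i (scoreX p.1 p.2 i i) := rfl

theorem GG_mono {D N : ℕ} (hN : 1 ≤ N) (p : (Fin N → Fin D → ℝ) × (Fin N → Fin D → ℝ))
    (i : Fin N) {x y : ℝ} (hxy : x ≤ y) : GG p i x ≤ GG p i y := by
  have : (1 : ℝ) ≤ N := by exact_mod_cast hN
  unfold GG
  refine div_le_div_of_nonneg_right (Finset.sum_le_sum fun j _ => ?_) (by linarith)
  split_ifs with h1 h2 <;> linarith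

theorem GG_le_one {D N : ℕ} (p : (Fin N → Fin D → ℝ) × (Fin N → Fin D → ℝ))
    (i : Fin N) (x : ℝ) : GG p i x ≤ 1 := by
  have hN : 1 ≤ N := Fin.pos i
  have h1 : (1 : ℝ) ≤ N := by exact_mod_cast hN
  unfold GG
  refine div_le_one_of_le₀ ?_ (by linarith)
  calc _ ≤ ∑ j ∈ Finset.univ.erase i, (1 : ℝ) := Finset.sum_le_sum fun j _ => by
        split_ifs <;> norm_num
    _ = _ := by simp [Finset.card_erase_of_mem, Nat.cast_sub hN]

theorem measurable_percentile {D N : ℕ} (i : Fin N) :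
    Measurable fun p : (Fin N → Fin D → ℝ) × (Fin N → Fin D → ℝ) => percentile p i := by
  unfold percentile
  refine Measurable.div_const (Finset.measurable_sum _ fun j _ => ?_) _
  exact Measurable.ite (measurableSet_le (measurable_score j i) (measurable_score i i))
    measurable_const measurable_const

theorem G_tip (h3 : ∀ m, 3 ≤ n m) (hn : Tendsto n atTop atTop)
    (hd1 : ∀ m, 1 ≤ d m) (hd : Tendsto d atTop atTop)
    {α : ℝ} (hα : 0 < α) (hlim : Tendsto (fun m => (n m : ℝ) / (d m : ℝ) ^ 2) atTop (𝓝 α))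
    (i : ∀ m, Fin (n m)) (x : ℝ) :
    TIP (fun m => gaussianModel (d m) (n m)) (fun m p => GG p (i m) x)
      ((gaussianReal 0 α.toNNReal).real (Set.Iic x)) := by
  have ha : Function.Injective (![1, 2] : Fin 2 → Fin 3) := by decide
  have h := avg_tip (μ := fun m => gaussianModel (d m) (n m))
    (fun m => Finset.univ.erase (i m)) (by
      simp only [Finset.card_erase_of_mem (Finset.mem_univ _), Finset.card_univ, Fintype.card_fin]
      exact (tendsto_sub_atTop_nat 1).comp hn)
    (fun m j => {p | scoreX p.1 p.2 j (i m) ≤ x})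
    (fun m j _ => measurableSet_le (measurable_score j (i m)) measurable_const)
    ((gaussianReal 0 α.toNNReal).real (Set.Iic x)) measureReal_nonneg measureReal_le_one
    (by
      intro ε hε
      have := uniform_of_select h3 (fun m e => (gaussianModel (d m) (n m)).real {p |
        scoreX p.1 p.2 (e 1) (e 0) ≤ x}) _
        (fun ι => by simpa using single_limit hd1 hd hα hlim ι ![1, 2] ![0, 0] ha x) hε
      filter_upwards [this] with m hm j hj
      obtain ⟨e, e0, e1⟩ := exists_emb2 (h3 m) (i m) j (Finset.ne_of_mem_erase hj).symm
      have := (hm e).le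
      rwa [e0, e1] at this)
    (by
      intro ε hε
      have := uniform_of_select h3 (fun m e => (gaussianModel (d m) (n m)).real {p |
        scoreX p.1 p.2 (e 1) (e 0) ≤ x ∧ scoreX p.1 p.2 (e 2) (e 0) ≤ x}) _
        (fun ι => by simpa using pair_limit hd1 hd hα hlim ι ![1, 2] ![0, 0] ha x x) hε
      filter_upwards [this] with m hm j hj k hk hjk
      obtain ⟨e, e0, e1, e2⟩ := exists_emb3 (i m) j k (Finset.ne_of_mem_erase hj).symm
        (Finset.ne_of_mem_erase hk).symm hjk
      have := (hm e).le
      rw [e0, e1, e2] at this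
      rw [sq]
      exact this)
  refine h.congr fun m p => ?_
  unfold GG
  have hN : 1 ≤ n m := by have := h3 m; omega
  simp only [Finset.card_erase_of_mem (Finset.mem_univ _), Finset.card_univ, Fintype.card_fin,
    Nat.cast_sub hN, Nat.cast_one]
  congr 1

theorem TIP.real {Ω : ℕ → Type} [∀ m, MeasurableSpace (Ω m)] {μ : ∀ m, Measure (Ω m)}
    {X : ∀ m, Ω m → ℝ} {c : ℝ} (h : TIP μ X c) {U : Set ℝ} (hU : U ∈ 𝓝 c) :
    Tendsto (fun m => (μ m).real {ω | X m ω ∉ U}) atTop (𝓝 0) := by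
  have := (ENNReal.tendsto_toReal ENNReal.zero_ne_top).comp (h U hU)
  simpa [Function.comp_def, Measure.real] using this

theorem bad_tendsto (h3 : ∀ m, 3 ≤ n m) (hn : Tendsto n atTop atTop)
    (hd1 : ∀ m, 1 ≤ d m) (hd : Tendsto d atTop atTop)
    {α : ℝ} (hα : 0 < α) (hlim : Tendsto (fun m => (n m : ℝ) / (d m : ℝ) ^ 2) atTop (𝓝 α))
    (i : ∀ m, Fin (n m)) (q : ℝ) :
    Tendsto (fun m => (gaussianModel (d m) (n m)).real {p |
      ¬ (percentile p (i m) ≤ (gaussianReal 0 α.toNNReal).real (Set.Iic q) ↔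
        scoreX p.1 p.2 (i m) (i m) ≤ q)}) atTop (𝓝 0) := by
  have hα' : α.toNNReal ≠ 0 := by simpa using hα
  set w := (gaussianReal 0 α.toNNReal).real (Set.Iic q) with hw
  rw [Metric.tendsto_nhds]
  intro ε hε
  obtain ⟨δ, hδ, hδ2⟩ : ∃ δ > 0, (gaussianReal 1 α.toNNReal).real (Set.Iic (q + δ)) -
      (gaussianReal 1 α.toNNReal).real (Set.Iic (q - δ)) < ε / 4 := by
    have hc := gcdf_continuous 1 hα'
    have hcc : Continuous fun δ => (gaussianReal 1 α.toNNReal).real (Set.Iic (q + δ)) -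
      (gaussianReal 1 α.toNNReal).real (Set.Iic (q - δ)) :=
      (hc.comp (continuous_const.add continuous_id)).sub
        (hc.comp (continuous_const.sub continuous_id))
    have ht := hcc.tendsto 0
    simp only [add_zero, sub_zero, sub_self] at ht
    have h2 := (ht.eventually (gt_mem_nhds (show (0 : ℝ) < ε / 4 by linarith)))
    obtain ⟨δ, h, h'⟩ := ((h2.filter_mono nhdsWithin_le_nhds).and
      (self_mem_nhdsWithin (s := Set.Ioi (0 : ℝ)))).exists
    exact ⟨δ, h', h⟩
  choose ι hι using fun m => exists_emb1 (h3 m) (i m)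
  have ha : Function.Injective (![0, 1] : Fin 2 → Fin 3) := by decide
  have l1 : ∀ x, Tendsto (fun m => (gaussianModel (d m) (n m)).real {p |
        scoreX p.1 p.2 (i m) (i m) ≤ x}) atTop
      (𝓝 ((gaussianReal 1 α.toNNReal).real (Set.Iic x))) := fun x => by
    have := single_limit hd1 hd hα hlim ι ![0, 1] ![0, 1] ha x
    simpa [hι] using this
  have l2 := (l1 (q + δ)).sub (l1 (q - δ))
  have sm := gcdf_strictMono 0 hα'
  have l3 := (G_tip h3 hn hd1 hd hα hlim i (q - δ)).real
    (U := Set.Iio w) (Iio_mem_nhds (sm (by linarith)))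
  have l4 := (G_tip h3 hn hd1 hd hα hlim i (q + δ)).real
    (U := Set.Ioi w) (Ioi_mem_nhds (sm (by linarith)))
  have hε4 : 0 < ε / 4 := by linarith
  filter_upwards [l2.eventually (gt_mem_nhds hδ2), l3.eventually (gt_mem_nhds hε4),
    l4.eventually (gt_mem_nhds hε4)] with m a1 a2 a3
  have hN : 1 ≤ n m := by have := h3 m; omega
  rw [Real.dist_eq, sub_zero, abs_of_nonneg measureReal_nonneg]
  have hdiff : (gaussianModel (d m) (n m)).real ({p | scoreX p.1 p.2 (i m) (i m) ≤ q + δ} \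
      {p | scoreX p.1 p.2 (i m) (i m) ≤ q - δ}) < ε / 4 := by
    rw [measureReal_sdiff]
    · exact a1
    · intro p hp
      simp only [Set.mem_ofPred_eq] at hp ⊢
      linarith
    · exact measurableSet_le (measurable_score _ _) measurable_const
  have hsub : {p : (Fin (n m) → Fin (d m) → ℝ) × (Fin (n m) → Fin (d m) → ℝ) |
      ¬ (percentile p (i m) ≤ w ↔ scoreX p.1 p.2 (i m) (i m) ≤ q)} ⊆
      (({p | scoreX p.1 p.2 (i m) (i m) ≤ q + δ} \ {p | scoreX p.1 p.2 (i m) (i m) ≤ q - δ}) ∪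
      {p | GG p (i m) (q - δ) ∉ Set.Iio w}) ∪ {p | GG p (i m) (q + δ) ∉ Set.Ioi w} := by
    intro p hp
    by_contra hc
    simp only [Set.mem_union, Set.mem_sdiff, Set.mem_ofPred_eq, Set.mem_Iio, Set.mem_Ioi,
      not_or, not_and, not_not] at hc
    obtain ⟨⟨c1, c2⟩, c3⟩ := hc
    apply hp
    rw [percentile_eq]
    rcases le_or_gt (scoreX p.1 p.2 (i m) (i m)) (q + δ) with h | h
    · have h' := c1 h
      exact iff_of_true ((GG_mono hN p (i m) h').trans c2.le) (by linarith)
    · refine iff_of_false (not_le.mpr (c3.trans_le (GG_mono hN p (i m) h.le))) (by linarith)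
  calc _ ≤ _ := measureReal_mono hsub
    _ ≤ _ := measureReal_union_le _ _
    _ ≤ _ := add_le_add_left (measureReal_union_le _ _) _
    _ < ε := by linarith

theorem squeeze_real {A B C : ℕ → ℝ} {L : ℝ} (hB : Tendsto B atTop (𝓝 L))
    (hC : Tendsto C atTop (𝓝 0)) (h1 : ∀ m, A m ≤ B m + C m) (h2 : ∀ m, B m ≤ A m + C m) :
    Tendsto A atTop (𝓝 L) := by
  refine tendsto_of_tendsto_of_tendsto_of_le_of_le (g := fun m => B m - C m)
    (h := fun m => B m + C m) ?_ ?_ (fun m => ?_) h1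
  · simpa using hB.sub hC
  · simpa using hB.add hC
  · have := h2 m
    show B m - C m ≤ A m
    linarith

theorem emp_tip (h3 : ∀ m, 3 ≤ n m) (hn : Tendsto n atTop atTop)
    (hd1 : ∀ m, 1 ≤ d m) (hd : Tendsto d atTop atTop)
    {α : ℝ} (hα : 0 < α) (hlim : Tendsto (fun m => (n m : ℝ) / (d m : ℝ) ^ 2) atTop (𝓝 α))
    (q : ℝ) :
    TIP (fun m => gaussianModel (d m) (n m))
      (fun m p => empPercCDF p ((gaussianReal 0 α.toNNReal).real (Set.Iic q)))
      ((gaussianReal 1 α.toNNReal).real (Set.Iic q)) := by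
  set w := (gaussianReal 0 α.toNNReal).real (Set.Iic q) with hw
  have ha : Function.Injective (![0, 1] : Fin 2 → Fin 3) := by decide
  have h := avg_tip (μ := fun m => gaussianModel (d m) (n m))
    (fun m => (Finset.univ : Finset (Fin (n m)))) (by
      simpa only [Finset.card_univ, Fintype.card_fin] using hn)
    (fun m j => {p | percentile p j ≤ w})
    (fun m j _ => measurableSet_le (measurable_percentile j) measurable_const)
    ((gaussianReal 1 α.toNNReal).real (Set.Iic q)) measureReal_nonneg measureReal_le_one
    (by
      intro ε hε
      have := uniform_of_select h3 (fun m e => (gaussianModel (d m) (n m)).real {p |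
        percentile p (e 0) ≤ w}) ((gaussianReal 1 α.toNNReal).real (Set.Iic q))
        (fun ι => by
          have l1 := single_limit hd1 hd hα hlim ι ![0, 1] ![0, 1] ha q
          simp only [Matrix.cons_val_zero, if_true] at l1
          refine squeeze_real l1 (bad_tendsto h3 hn hd1 hd hα hlim (fun m => ι m 0) q) ?_ ?_
          · intro m
            refine (measureReal_mono ?_).trans (measureReal_union_le _ _)
            intro p hp
            simp only [Set.mem_union, Set.mem_ofPred_eq] at hp ⊢
            tauto
          · intro m
            refine (measureReal_mono ?_).trans (measureReal_union_le _ _)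
            intro p hp
            simp only [Set.mem_union, Set.mem_ofPred_eq] at hp ⊢
            tauto) hε
      filter_upwards [this] with m hm j hj
      obtain ⟨e, e0⟩ := exists_emb1 (h3 m) j
      have := (hm e).le
      rwa [e0] at this)
    (by
      intro ε hε
      have := uniform_of_select h3 (fun m e => (gaussianModel (d m) (n m)).real {p |
        percentile p (e 0) ≤ w ∧ percentile p (e 1) ≤ w})
        ((gaussianReal 1 α.toNNReal).real (Set.Iic q) ^ 2)
        (fun ι => by
          have l1 := pair_limit hd1 hd hα hlim ι ![0, 1] ![0, 1] ha q q
          simp only [Matrix.cons_val_zero, Matrix.cons_val_one, if_true, ← sq] at l1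
          have l2 := (bad_tendsto h3 hn hd1 hd hα hlim (fun m => ι m 0) q).add
            (bad_tendsto h3 hn hd1 hd hα hlim (fun m => ι m 1) q)
          rw [add_zero] at l2
          refine squeeze_real l1 l2 ?_ ?_
          · intro m
            refine (measureReal_mono ?_).trans ((measureReal_union_le _ _).trans
              (add_le_add_right (measureReal_union_le _ _) _))
            intro p hp
            simp only [Set.mem_union, Set.mem_ofPred_eq] at hp ⊢
            tauto
          · intro m
            refine (measureReal_mono ?_).trans ((measureReal_union_le _ _).trans
              (add_le_add_right (measureReal_union_le _ _) _))
            intro p hp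
            simp only [Set.mem_union, Set.mem_ofPred_eq] at hp ⊢
            tauto) hε
      filter_upwards [this] with m hm j hj k hk hjk
      obtain ⟨e, e0, e1⟩ := exists_emb2 (h3 m) j k hjk
      have := (hm e).le
      rw [e0, e1] at this
      exact this)
  refine h.congr fun m p => ?_
  unfold empPercCDF
  simp only [Finset.card_univ, Fintype.card_fin]
  congr 1

theorem emp_tip_Phi (h3 : ∀ m, 3 ≤ n m) (hn : Tendsto n atTop atTop)
    (hd1 : ∀ m, 1 ≤ d m) (hd : Tendsto d atTop atTop)
    {α : ℝ} (hα : 0 < α) (hlim : Tendsto (fun m => (n m : ℝ) / (d m : ℝ) ^ 2) atTop (𝓝 α))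
    (x : ℝ) :
    TIP (fun m => gaussianModel (d m) (n m))
      (fun m p => empPercCDF p (Phi x)) (Phi (x - 1 / √α)) := by
  have hs : √α ≠ 0 := (Real.sqrt_pos.mpr hα).ne'
  have := emp_tip h3 hn hd1 hd hα hlim (√α * x)
  rw [gcdf_eq_Phi 1 hα, gcdf_eq_Phi 0 hα] at this
  have e1 : (√α * x - 0) / √α = x := by rw [sub_zero, mul_div_cancel_left₀ x hs]
  have e2 : (√α * x - 1) / √α = x - 1 / √α := by rw [sub_div, mul_div_cancel_left₀ x hs]
  rwa [e1, e2] at this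

theorem emp_mono {D N : ℕ} (p : (Fin N → Fin D → ℝ) × (Fin N → Fin D → ℝ)) {x y : ℝ}
    (hxy : x ≤ y) : empPercCDF p x ≤ empPercCDF p y := by
  unfold empPercCDF
  refine div_le_div_of_nonneg_right (Finset.sum_le_sum fun j _ => ?_) (by positivity)
  split_ifs with h1 h2 <;> linarith

theorem emp_nonneg {D N : ℕ} (p : (Fin N → Fin D → ℝ) × (Fin N → Fin D → ℝ)) (x : ℝ) :
    0 ≤ empPercCDF p x := by
  unfold empPercCDF
  refine div_nonneg (Finset.sum_nonneg fun j _ => ?_) (by positivity)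
  split_ifs <;> norm_num

theorem emp_one {D N : ℕ} (hN : 1 ≤ N) (p : (Fin N → Fin D → ℝ) × (Fin N → Fin D → ℝ)) :
    empPercCDF p 1 = 1 := by
  have h : ∀ i, percentile p i ≤ 1 := fun i => GG_le_one p i _
  have : (N : ℝ) ≠ 0 := by positivity
  simp [empPercCDF, h, this]

theorem main_shifted (h3 : ∀ m, 3 ≤ n m) (hn : Tendsto n atTop atTop)
    (hd1 : ∀ m, 1 ≤ d m) (hd : Tendsto d atTop atTop)
    {α : ℝ} (hα : 0 < α) (hlim : Tendsto (fun m => (n m : ℝ) / (d m : ℝ) ^ 2) atTop (𝓝 α))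
    (w : ℝ) (hw : w ∈ Set.Icc (0 : ℝ) 1) (ε : ℝ) (hε : 0 < ε) :
      Tendsto (fun m => gaussianModel (d m) (n m)
          {p | ε ≤ |empPercCDF p w - limitPercCDF α w|}) atTop (𝓝 (0 : ENNReal)) := by
  rcases hw.1.eq_or_lt with h0 | h0
  · subst h0
    have hx : Tendsto (fun x => Phi (x - 1 / √α)) atBot (𝓝 0) :=
      Phi_atBot.comp (tendsto_atBot_add_const_right _ _ tendsto_id)
    obtain ⟨x, hx⟩ := (hx.eventually (gt_mem_nhds hε)).exists
    have h := emp_tip_Phi h3 hn hd1 hd hα hlim x (Set.Iio ε) (Iio_mem_nhds hx)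
    refine tendsto_of_tendsto_of_tendsto_of_le_of_le tendsto_const_nhds h
      (fun m => zero_le) (fun m => measure_mono fun p hp => ?_)
    simp only [limitPercCDF, le_refl, if_true, sub_zero, Set.mem_ofPred_eq, Set.mem_Iio,
      not_lt] at hp ⊢
    rw [abs_of_nonneg (emp_nonneg p 0)] at hp
    exact hp.trans (emp_mono p (Phi_pos x).le)
  rcases hw.2.eq_or_lt with h1 | h1
  · subst h1
    have : ∀ m, gaussianModel (d m) (n m) {p | ε ≤ |empPercCDF p 1 - limitPercCDF α 1|} = 0 := by
      intro m
      have hN : 1 ≤ n m := by have := h3 m; omega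
      simp [emp_one hN, limitPercCDF, not_le.mpr hε, not_le.mpr (zero_lt_one' ℝ)]
    simp [this]
  · obtain ⟨x, rfl⟩ := exists_Phi h0 h1
    have h := (emp_tip_Phi h3 hn hd1 hd hα hlim x).abs hε
    simpa [limitPercCDF, not_le.mpr h0, not_le.mpr h1, PhiInv_Phi] using h

end fin

/-- **Empirical percentile law.** If `n, d → ∞` with `n/d² → α ∈ (0,∞)`, then for every
`ω ∈ [0,1]` the empirical percentile CDF `F_n(ω)` converges in probability to `F(ω)`. -/
theorem empirical_percentile_cdf_convergence (α : ℝ) (hα : 0 < α) (n d : ℕ → ℕ)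
    (hn : Tendsto n atTop atTop) (hd : Tendsto d atTop atTop)
    (hlim : Tendsto (fun m => (n m : ℝ) / (d m : ℝ) ^ 2) atTop (𝓝 α)) :
    ∀ ω ∈ Set.Icc (0 : ℝ) 1, ∀ ε : ℝ, 0 < ε →
      Tendsto (fun m => gaussianModel (d m) (n m)
          {p | ε ≤ |empPercCDF p ω - limitPercCDF α ω|}) atTop (𝓝 (0 : ENNReal)) := by
  intro ω hω ε hε
  obtain ⟨M, hM⟩ := eventually_atTop.mp ((hn.eventually_ge_atTop 3).and (hd.eventually_ge_atTop 1))
  rw [← tendsto_add_atTop_iff_nat M]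
  have hsh : Tendsto (fun m => m + M) atTop atTop := tendsto_add_atTop_nat M
  exact main_shifted (n := fun m => n (m + M)) (d := fun m => d (m + M))
    (fun m => (hM _ (Nat.le_add_left _ _)).1) (hn.comp hsh)
    (fun m => (hM _ (Nat.le_add_left _ _)).2) (hd.comp hsh) hα (hlim.comp hsh) ω hω ε hε

end
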